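/- arXiv:1502.06511 — 2 statements merged into one kernel-verified Lean document; each statement's English description precedes it below -/
import Mathlib

section
/- Let E ⊆ ℝ² be a bounded set of finite perimeter such that for a.e. θ ∈ [0, π] the marginal w_θ of 1_E in direction θ has convex (interval) support A_θ and is locally Lipschitz in the interior of A_θ, with |w_θ′| ≤ C_δ a.e. on {t ∈ A_θ : dist(t, ∂A_θ) ≥ δ} uniformly in θ for each δ > 0. Then E coincides with a convex set up to a set of Lebesgue measure zero. -/
open MeasureTheory Set Real

/-- Divergence of a vector field on `ℝ²`. -/
noncomputable def diverg (φ : EuclideanSpace ℝ (Fin 2) → EuclideanSpace ℝ (Fin 2))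
    (x : EuclideanSpace ℝ (Fin 2)) : ℝ :=
  ∑ i : Fin 2, fderiv ℝ φ x (EuclideanSpace.single i 1) i

/-- Values `∫ u · div φ` over smooth compactly supported vector fields with `‖φ‖ ≤ 1`. -/
def varSet (u : EuclideanSpace ℝ (Fin 2) → ℝ) : Set ℝ :=
  {r | ∃ φ : EuclideanSpace ℝ (Fin 2) → EuclideanSpace ℝ (Fin 2),
    ContDiff ℝ (⊤ : ℕ∞) φ ∧ HasCompactSupport φ ∧ (∀ x, ‖φ x‖ ≤ 1) ∧
    r = ∫ x, u x * diverg φ x}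

/-- `E ⊆ ℝ²` has finite perimeter: `1_E ∈ BV(ℝ²)`. -/
def HasFinitePerimeter (E : Set (EuclideanSpace ℝ (Fin 2))) : Prop :=
  MeasurableSet E ∧ BddAbove (varSet (E.indicator (fun _ => (1 : ℝ))))

/-- The counterclockwise rotation by `θ` in `ℝ²`, applied to the point `(t, s)`. -/
noncomputable def rot (θ t s : ℝ) : EuclideanSpace ℝ (Fin 2) :=
  (WithLp.equiv 2 (Fin 2 → ℝ)).symm ![t * cos θ - s * sin θ, t * sin θ + s * cos θ]

/-- Marginal of `1_E` in direction `θ`: `w_θ(t) = ℋ¹({s : R_θ(t,s) ∈ E})`. -/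
noncomputable def margInd (E : Set (EuclideanSpace ℝ (Fin 2))) (θ t : ℝ) : ℝ :=
  (volume {s : ℝ | rot θ t s ∈ E}).toReal

/-- The support `A_θ = {w_θ > 0}` of the marginal. -/
def Asupp (E : Set (EuclideanSpace ℝ (Fin 2))) (θ : ℝ) : Set ℝ :=
  {t | 0 < margInd E θ t}

section RotationCoordinates

/-- The signed length of the projection of `x` onto the direction `(cos θ, sin θ)`. -/
noncomputable def proj (θ : ℝ) (x : EuclideanSpace ℝ (Fin 2)) : ℝ :=
  x 0 * cos θ + x 1 * sin θ

theorem proj_rot (θ t s : ℝ) : proj θ (rot θ t s) = t := by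
  simp [proj, rot]
  linear_combination t * Real.cos_sq_add_sin_sq θ

theorem proj_sub (θ : ℝ) (x y : EuclideanSpace ℝ (Fin 2)) :
    proj θ (x - y) = proj θ x - proj θ y := by
  simp [proj]; ring

theorem norm_rot_sq (θ t s : ℝ) : ‖rot θ t s‖ ^ 2 = t ^ 2 + s ^ 2 := by
  rw [EuclideanSpace.norm_sq_eq]
  simp [rot, Fin.sum_univ_two]
  linear_combination (t ^ 2 + s ^ 2) * Real.cos_sq_add_sin_sq θ

theorem norm_rot_zero_right (θ t : ℝ) : ‖rot θ t 0‖ = |t| := by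
  have := norm_rot_sq θ t 0
  rw [← abs_norm, ← sq_eq_sq_iff_abs_eq_abs, this]; ring

theorem rot_add (θ t t' s s' : ℝ) : rot θ (t + t') (s + s') = rot θ t s + rot θ t' s' := by
  ext i; fin_cases i <;> simp [rot] <;> ring

theorem abs_proj_le (θ : ℝ) (x : EuclideanSpace ℝ (Fin 2)) : |proj θ x| ≤ ‖x‖ := by
  apply abs_le_of_sq_le_sq _ (norm_nonneg _)
  rw [EuclideanSpace.norm_sq_eq, proj]
  simp only [Fin.sum_univ_two, Real.norm_eq_abs, sq_abs]
  nlinarith [sq_nonneg (x 0 * sin θ - x 1 * cos θ), Real.cos_sq_add_sin_sq θ,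
    sq_nonneg (x 0), sq_nonneg (x 1)]

theorem continuous_proj : Continuous fun p : ℝ × EuclideanSpace ℝ (Fin 2) => proj p.1 p.2 := by
  unfold proj; fun_prop

theorem measurable_proj (θ : ℝ) : Measurable (proj θ) :=
  (continuous_proj.comp (Continuous.prodMk_right θ)).measurable

theorem continuous_rot (θ : ℝ) : Continuous fun p : ℝ × ℝ => rot θ p.1 p.2 := by
  have : (fun p : ℝ × ℝ => rot θ p.1 p.2) = fun p => WithLp.toLp 2
      ![p.1 * cos θ - p.2 * sin θ, p.1 * sin θ + p.2 * cos θ] := rfl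
  rw [this]
  refine (PiLp.continuous_toLp 2 _).comp (continuous_pi fun i => ?_)
  fin_cases i <;> simp <;> fun_prop

theorem measurePreserving_rot (θ : ℝ) :
    MeasurePreserving (fun p : ℝ × ℝ => rot θ p.1 p.2) volume volume := by
  let L : (Fin 2 → ℝ) →ₗ[ℝ] (Fin 2 → ℝ) :=
    Matrix.toLin' !![cos θ, - sin θ; sin θ, cos θ]
  have hdet : LinearMap.det L = 1 := by
    simp only [L, LinearMap.det_toLin', Matrix.det_fin_two_of]
    linear_combination Real.cos_sq_add_sin_sq θ
  have hL : MeasurePreserving L volume volume := by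
    refine ⟨(LinearMap.continuous_of_finiteDimensional L).measurable, ?_⟩
    rw [Real.map_linearMap_volume_pi_eq_smul_volume_pi (by rw [hdet]; exact one_ne_zero), hdet]
    simp
  have h := ((PiLp.volume_preserving_toLp (Fin 2)).comp hL).comp
    (volume_preserving_finTwoArrow ℝ).symm
  convert h using 1
  · rfl
  refine funext fun p => PiLp.ext fun i => ?_
  fin_cases i <;> simp [rot, L, MeasurableEquiv.finTwoArrow, Matrix.vecHead, Matrix.vecTail,
    Matrix.toLin'_apply] <;> ring

theorem lintegral_rot (θ : ℝ) {f : EuclideanSpace ℝ (Fin 2) → ENNReal} (hf : Measurable f) :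
    ∫⁻ t, ∫⁻ s, f (rot θ t s) = ∫⁻ x, f x := by
  rw [← (measurePreserving_rot θ).lintegral_comp hf]
  exact (lintegral_prod _ (hf.comp (continuous_rot θ).measurable).aemeasurable).symm

/-- The length of the slice of `E` over the point `t` of the line of direction `θ`. -/
noncomputable def slice (E : Set (EuclideanSpace ℝ (Fin 2))) (θ t : ℝ) : ENNReal :=
  volume {s : ℝ | rot θ t s ∈ E}

theorem slice_eq_lintegral {E : Set (EuclideanSpace ℝ (Fin 2))} (hE : MeasurableSet E)
    (θ t : ℝ) : slice E θ t = ∫⁻ s, E.indicator 1 (rot θ t s) := by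
  have hm : MeasurableSet {s : ℝ | rot θ t s ∈ E} :=
    ((continuous_rot θ).measurable.comp measurable_prodMk_left) hE
  rw [slice, ← lintegral_indicator_one hm]
  rfl

theorem measurable_slice {E : Set (EuclideanSpace ℝ (Fin 2))} (hE : MeasurableSet E)
    (θ : ℝ) : Measurable (slice E θ) := by
  simp_rw [funext (slice_eq_lintegral hE θ)]
  exact Measurable.lintegral_prod_right'
    (f := fun p : ℝ × ℝ => E.indicator (1 : EuclideanSpace ℝ (Fin 2) → ENNReal) (rot θ p.1 p.2))
    ((measurable_one.indicator hE).comp (continuous_rot θ).measurable)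

theorem lintegral_mul_slice {E : Set (EuclideanSpace ℝ (Fin 2))} (hE : MeasurableSet E)
    (θ : ℝ) {f : ℝ → ENNReal} (hf : Measurable f) :
    ∫⁻ t, f t * slice E θ t = ∫⁻ x in E, f (proj θ x) := by
  have hm : ∀ t, Measurable fun s =>
      E.indicator (1 : EuclideanSpace ℝ (Fin 2) → ENNReal) (rot θ t s) := fun t =>
    (measurable_one.indicator hE).comp ((continuous_rot θ).measurable.comp measurable_prodMk_left)
  rw [← lintegral_indicator hE, ← lintegral_rot θ
    (Measurable.indicator (f := fun x => f (proj θ x)) (hf.comp (measurable_proj θ)) hE)]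
  refine lintegral_congr fun t => ?_
  rw [slice_eq_lintegral hE, ← lintegral_const_mul _ (hm t)]
  refine lintegral_congr fun s => ?_
  by_cases h : rot θ t s ∈ E <;> simp [h, proj_rot]

theorem slice_le_of_subset_ball {E : Set (EuclideanSpace ℝ (Fin 2))} {R : ℝ}
    (hE : E ⊆ Metric.ball 0 R) (θ t : ℝ) : slice E θ t ≤ ENNReal.ofReal (2 * R) := by
  have : {s : ℝ | rot θ t s ∈ E} ⊆ Icc (-R) R := fun s hs => by
    have h := mem_ball_zero_iff.1 (hE hs)
    have h2 := norm_rot_sq θ t s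
    apply abs_le.1
    apply abs_le_of_sq_le_sq _ ((norm_nonneg _).trans h.le)
    nlinarith [norm_nonneg (rot θ t s), sq_nonneg t]
  calc slice E θ t ≤ volume (Icc (-R) R) := measure_mono this
    _ = _ := by rw [Real.volume_Icc]; ring_nf

theorem slice_eq_zero_of_proj {E : Set (EuclideanSpace ℝ (Fin 2))} {θ c r t : ℝ}
    (hE : ∀ x ∈ E, |proj θ x - c| < r) (ht : r ≤ |t - c|) : slice E θ t = 0 := by
  have : {s : ℝ | rot θ t s ∈ E} = ∅ := by
    ext s
    simp only [mem_ofPred_eq, mem_empty_iff_false, iff_false]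
    intro hs
    have := hE _ hs
    rw [proj_rot] at this
    linarith
  rw [slice, this, measure_empty]

/-- The marginal of a centred disc. -/
theorem slice_ball {R : ℝ} (hR : 0 < R) (θ t : ℝ) :
    slice (Metric.ball 0 R) θ t = ENNReal.ofReal (2 * √(R ^ 2 - t ^ 2)) := by
  have : {s : ℝ | rot θ t s ∈ Metric.ball (0 : EuclideanSpace ℝ (Fin 2)) R} =
      Ioo (-√(R ^ 2 - t ^ 2)) (√(R ^ 2 - t ^ 2)) := by
    ext s
    rw [mem_ofPred_eq, mem_ball_zero_iff, mem_Ioo, ← abs_lt, Real.lt_sqrt (abs_nonneg _), sq_abs,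
      ← abs_of_pos hR, ← abs_norm, ← sq_lt_sq, norm_rot_sq, abs_of_pos hR]
    constructor <;> intro h <;> linarith
  rw [slice, this, Real.volume_Ioo]; ring_nf

end RotationCoordinates

section TranslationEstimate

theorem diverg_smul_const {ψ : EuclideanSpace ℝ (Fin 2) → ℝ} (hψ : Differentiable ℝ ψ)
    (u x : EuclideanSpace ℝ (Fin 2)) :
    diverg (fun y => ψ y • u) x = fderiv ℝ ψ x u := by
  have h : fderiv ℝ (fun y => ψ y • u) x = (fderiv ℝ ψ x).smulRight u :=
    ((hψ x).hasFDerivAt.smul_const u).fderiv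
  have hu : u = u 0 • EuclideanSpace.single 0 (1 : ℝ) + u 1 • EuclideanSpace.single 1 (1 : ℝ) := by
    ext i; fin_cases i <;> simp
  conv_rhs => rw [hu]
  simp only [diverg, h, Fin.sum_univ_two, map_add, map_smul, ContinuousLinearMap.smulRight_apply,
    PiLp.smul_apply, smul_eq_mul]
  ring

theorem setIntegral_fderiv_le {E : Set (EuclideanSpace ℝ (Fin 2))} (hE : MeasurableSet E) {P : ℝ}
    (hP : P ∈ upperBounds (varSet (E.indicator fun _ => (1 : ℝ))))
    {ψ : EuclideanSpace ℝ (Fin 2) → ℝ} (hψ : ContDiff ℝ (⊤ : ℕ∞) ψ) (hψc : HasCompactSupport ψ)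
    (hψ1 : ∀ x, |ψ x| ≤ 1) (v : EuclideanSpace ℝ (Fin 2)) :
    ∫ x in E, fderiv ℝ ψ x v ≤ P * ‖v‖ := by
  rcases eq_or_ne v 0 with rfl | hv
  · simp
  have hv' : 0 < ‖v‖ := norm_pos_iff.2 hv
  have key : ∫ x in E, fderiv ℝ ψ x (‖v‖⁻¹ • v) ≤ P := by
    refine hP ⟨fun y => ψ y • (‖v‖⁻¹ • v), hψ.smul contDiff_const, hψc.smul_right, fun x => ?_, ?_⟩
    · rw [norm_smul, norm_smul, norm_inv, norm_norm, inv_mul_cancel₀ hv'.ne', mul_one]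
      exact hψ1 x
    · rw [← integral_indicator hE]
      refine integral_congr_ae (Filter.Eventually.of_forall fun x => ?_)
      by_cases hx : x ∈ E <;>
        simp [hx, diverg_smul_const (hψ.differentiable (by simp))]
  simp only [map_smul, smul_eq_mul, integral_const_mul] at key
  rwa [inv_mul_le_iff₀ hv', mul_comm] at key

theorem setIntegral_sub_translate_le {E : Set (EuclideanSpace ℝ (Fin 2))} (hE : MeasurableSet E)
    (hEf : volume E ≠ ⊤) {P : ℝ} (hP : P ∈ upperBounds (varSet (E.indicator fun _ => (1 : ℝ))))
    {ψ : EuclideanSpace ℝ (Fin 2) → ℝ} (hψ : ContDiff ℝ (⊤ : ℕ∞) ψ) (hψc : HasCompactSupport ψ)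
    (hψ1 : ∀ x, |ψ x| ≤ 1) (v : EuclideanSpace ℝ (Fin 2)) :
    ∫ x in E, (ψ x - ψ (x - v)) ≤ P * ‖v‖ := by
  have hcont : Continuous (fderiv ℝ ψ) := hψ.continuous_fderiv (by simp)
  have hFTC : ∀ x, ψ x - ψ (x - v) = ∫ s in (0 : ℝ)..1, fderiv ℝ ψ (x - s • v) v := fun x => by
    have hd : ∀ s ∈ uIcc (0 : ℝ) 1,
        HasDerivAt (fun s : ℝ => - ψ (x - s • v)) (fderiv ℝ ψ (x - s • v) v) s := fun s _ => by
      have h1 : HasDerivAt (fun s : ℝ => x - s • v) (-v) s := by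
        simpa using ((hasDerivAt_id s).smul_const v).const_sub x
      have h2 := ((hψ.differentiable (by simp) (x - s • v)).hasFDerivAt.comp_hasDerivAt s h1).neg
      rw [map_neg, neg_neg] at h2
      exact h2
    rw [intervalIntegral.integral_eq_sub_of_hasDerivAt hd
      (Continuous.intervalIntegrable (by fun_prop) _ _)]
    simp; ring
  obtain ⟨M, hM⟩ : ∃ M, ∀ x, ‖fderiv ℝ ψ x‖ ≤ M :=
    (hψc.fderiv ℝ).exists_bound_of_continuous hcont
  have : IsFiniteMeasure (volume.restrict E) := ⟨by simpa using hEf.lt_top⟩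
  have hint : Integrable (Function.uncurry fun (x : EuclideanSpace ℝ (Fin 2)) (s : ℝ) =>
      fderiv ℝ ψ (x - s • v) v) ((volume.restrict E).prod (volume.restrict (Ioc 0 1))) := by
    refine Integrable.of_bound (C := M * ‖v‖) ?_ (Filter.Eventually.of_forall fun p => ?_)
    · have : Continuous (Function.uncurry fun (x : EuclideanSpace ℝ (Fin 2)) (s : ℝ) =>
          fderiv ℝ ψ (x - s • v) v) := by
        simp only [Function.uncurry_def]; fun_prop
      exact this.aestronglyMeasurable
    · exact (ContinuousLinearMap.le_opNorm _ _).trans (by gcongr; exact hM _)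
  simp_rw [hFTC, intervalIntegral.integral_of_le zero_le_one]
  rw [integral_integral_swap hint, ← intervalIntegral.integral_of_le zero_le_one]
  have hle : ∀ s : ℝ, ∫ x in E, fderiv ℝ ψ (x - s • v) v ≤ P * ‖v‖ := fun s => by
    have := setIntegral_fderiv_le hE hP (ψ := fun x => ψ (x - s • v))
      (hψ.comp (contDiff_id.sub contDiff_const))
      (hψc.comp_homeomorph (Homeomorph.subRight (s • v))) (fun x => hψ1 _) v
    simpa only [fderiv_comp_sub] using this
  calc ∫ s in (0 : ℝ)..1, ∫ x in E, fderiv ℝ ψ (x - s • v) v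
      ≤ ∫ s in (0 : ℝ)..1, P * ‖v‖ := by
        refine intervalIntegral.integral_mono_on zero_le_one ?_ (by simp) fun s _ => hle s
        rw [intervalIntegrable_iff_integrableOn_Ioc_of_le zero_le_one]
        exact hint.integral_prod_right
    _ = P * ‖v‖ := by simp

theorem exists_smooth_cutoff {K U : Set (EuclideanSpace ℝ (Fin 2))} (hK : IsCompact K)
    (hU : IsOpen U) (hKU : K ⊆ U) :
    ∃ ψ : EuclideanSpace ℝ (Fin 2) → ℝ, ContDiff ℝ (⊤ : ℕ∞) ψ ∧ HasCompactSupport ψ ∧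
      (∀ x ∉ U, ψ x = 0) ∧ (∀ x ∈ K, ψ x = 1) ∧ ∀ x, ψ x ∈ Icc (0 : ℝ) 1 := by
  obtain ⟨R, hR⟩ := hK.isBounded.subset_ball 0
  obtain ⟨f, hf0, hf1, hf⟩ := exists_contMDiffMap_zero_one_of_isClosed (n := (⊤ : ℕ∞))
    (modelWithCornersSelf ℝ (EuclideanSpace ℝ (Fin 2)))
    (s := (U ∩ Metric.ball 0 R)ᶜ) (t := K) (hU.inter Metric.isOpen_ball).isClosed_compl
    hK.isClosed (disjoint_compl_left_iff_subset.2 (subset_inter hKU hR))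
  refine ⟨f, f.contMDiff.contDiff, ?_, fun x hx => hf0 fun h => hx h.1, fun x hx => hf1 hx, hf⟩
  refine HasCompactSupport.intro (isCompact_closedBall 0 R) fun x hx => hf0 fun h => hx ?_
  exact Metric.ball_subset_closedBall h.2

/-- The measure of the part of a set of finite perimeter which a translation moves out of the set
is at most proportional to the length of the translation. -/
theorem exists_volume_translate_diff_le {E : Set (EuclideanSpace ℝ (Fin 2))}
    (hEb : Bornology.IsBounded E) (hEp : HasFinitePerimeter E) :
    ∃ P : ℝ, 0 ≤ P ∧ ∀ v, volume {x ∈ E | x + v ∉ E} ≤ ENNReal.ofReal (P * ‖v‖) := by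
  obtain ⟨hE, P, hP⟩ := hEp
  have hEf : volume E ≠ ⊤ := hEb.measure_lt_top.ne
  refine ⟨P, hP ⟨0, contDiff_const, HasCompactSupport.zero, by simp, by simp [diverg]⟩,
    fun v => ?_⟩
  set D : Set (EuclideanSpace ℝ (Fin 2)) := {x ∈ E | x + v ∉ E} with hDdef
  have hE' : MeasurableSet {x | x + v ∈ E} := measurable_add_const v hE
  have hD : MeasurableSet D := hE.inter hE'.compl
  have hDE : D ⊆ E := fun x hx => hx.1
  have hDf : volume D ≠ ⊤ := measure_ne_top_of_subset hDE hEf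
  refine ENNReal.le_of_forall_pos_le_add fun ε hε _ => ?_
  obtain ⟨K, hKD, hK, hDK⟩ := hD.exists_isCompact_lt_add hDf
    (ε := ENNReal.ofReal (ε / 2)) (by simpa using hε)
  have hKf : volume K ≠ ⊤ := hK.measure_lt_top.ne
  obtain ⟨U, hKU, hU, hUf, hUK⟩ := hK.measurableSet.exists_isOpen_sdiff_lt hKf
    (ε := ENNReal.ofReal (ε / 2)) (by simpa using hε)
  obtain ⟨ψ, hψ, hψc, hψU, hψK, hψ1⟩ := exists_smooth_cutoff hK hU hKU
  have hψi : Integrable ψ := hψ.continuous.integrable_of_hasCompactSupport hψc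
  have hle := setIntegral_sub_translate_le hE hEf hP hψ hψc
    (fun x => abs_le.2 ⟨by linarith [(hψ1 x).1], (hψ1 x).2⟩) v
  have hψi' : Integrable fun x => ψ (x - v) := hψi.comp_sub_right v
  have heq : ∫ x in E, (ψ x - ψ (x - v)) =
      ∫ x, (E.indicator 1 x - {x | x + v ∈ E}.indicator 1 x) * ψ x := by
    rw [integral_sub hψi.integrableOn hψi'.integrableOn, ← integral_indicator hE,
      ← integral_indicator hE, ← integral_add_right_eq_self (E.indicator fun x => ψ (x - v)) v,
      ← integral_sub (hψi.indicator hE)]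
    · refine integral_congr_ae (Filter.Eventually.of_forall fun x => ?_)
      by_cases h1 : x ∈ E <;> by_cases h2 : x + v ∈ E <;> simp [h1, h2]
    · exact (hψi'.indicator hE).comp_add_right v
  have hlow : volume.real K - volume.real (U \ K) ≤
      ∫ x, (E.indicator 1 x - {x | x + v ∈ E}.indicator 1 x) * ψ x := by
    have hUKm : MeasurableSet (U \ K) := hU.measurableSet.diff hK.measurableSet
    rw [← integral_indicator_one hK.measurableSet, ← integral_indicator_one hUKm, ← integral_sub]
    · refine integral_mono ?_ ?_ fun x => ?_
      · exact ((integrable_indicator_iff hK.measurableSet).2 (integrableOn_const hKf)).sub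
          ((integrable_indicator_iff hUKm).2 (integrableOn_const (hUK.trans_le le_top).ne))
      · refine hψi.bdd_mul (c := 1) ?_ (Filter.Eventually.of_forall fun x => ?_)
        · exact ((measurable_one.indicator hE).sub
            (measurable_one.indicator hE')).aestronglyMeasurable
        · by_cases h1 : x ∈ E <;> by_cases h2 : x + v ∈ E <;> simp [h1, h2]
      · have h0 := hψ1 x
        by_cases hxK : x ∈ K
        · have h1 : x ∈ E := (hKD hxK).1
          have h2 : x + v ∉ E := (hKD hxK).2
          simp [hxK, h1, h2, hψK x hxK]
        · by_cases hxU : x ∈ U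
          · by_cases h1 : x ∈ E <;> by_cases h2 : x + v ∈ E <;> simp [h1, h2, hxK, hxU] <;>
              linarith [h0.1, h0.2]
          · simp [hxK, hxU, hψU x hxU]
    · exact (integrable_indicator_iff hK.measurableSet).2 (integrableOn_const hKf)
    · exact (integrable_indicator_iff hUKm).2 (integrableOn_const (hUK.trans_le le_top).ne)
  have h1 : volume.real (U \ K) ≤ ε / 2 := ENNReal.toReal_le_of_le_ofReal (by positivity) hUK.le
  calc volume D ≤ volume K + ENNReal.ofReal (ε / 2) := hDK.le
    _ = ENNReal.ofReal (volume.real K) + ENNReal.ofReal (ε / 2) := by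
        rw [Measure.real, ENNReal.ofReal_toReal hKf]
    _ ≤ ENNReal.ofReal (P * ‖v‖ + ε / 2) + ENNReal.ofReal (ε / 2) := by
        gcongr; linarith
    _ ≤ ENNReal.ofReal (P * ‖v‖) + ENNReal.ofReal (ε / 2) + ENNReal.ofReal (ε / 2) := by
        gcongr; exact ENNReal.ofReal_add_le
    _ = ENNReal.ofReal (P * ‖v‖) + ε := by
        rw [add_assoc, ← ENNReal.ofReal_add (by positivity) (by positivity), add_halves,
          ENNReal.ofReal_coe_nnreal]

end TranslationEstimate

section OneVariable

/-- A locally Lipschitz function on a compact interval whose derivative is almost everywhere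
bounded by `C` is `C`-Lipschitz. -/
theorem abs_sub_le_of_ae_abs_deriv_le {w : ℝ → ℝ} {a b C : ℝ}
    (hw : ∀ t ∈ Icc a b, ∃ ε > (0 : ℝ), ∃ K : NNReal, LipschitzOnWith K w (Metric.ball t ε))
    (hC : ∀ᵐ t ∂(volume.restrict (Icc a b)), |deriv w t| ≤ C) {s t : ℝ}
    (hs : s ∈ Icc a b) (ht : t ∈ Icc a b) : |w t - w s| ≤ C * |t - s| := by
  obtain ⟨K, hK⟩ : ∃ K, LipschitzOnWith K w (Icc a b) := by
    refine LocallyLipschitzOn.exists_lipschitzOnWith_of_compact isCompact_Icc fun x hx => ?_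
    obtain ⟨ε, hε, K, hK⟩ := hw x hx
    exact ⟨K, Metric.ball x ε, mem_nhdsWithin_of_mem_nhds (Metric.ball_mem_nhds x hε), hK⟩
  have hsub : uIcc s t ⊆ Icc a b := ordConnected_Icc.uIcc_subset hs ht
  rw [← (hK.mono hsub).absolutelyContinuousOnInterval.integral_deriv_eq_sub]
  refine intervalIntegral.norm_integral_le_of_norm_le_const_ae (f := deriv w) ?_
  rw [ae_restrict_iff' measurableSet_Icc] at hC
  filter_upwards [hC] with x hx hxs
  exact hx (hsub (uIoc_subset_uIcc hxs))

/-- Second order differences of the correlation of a Lipschitz function and a function of bounded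
variation are quadratically small. -/
theorem abs_correlation_sub_le {v g : ℝ → ℝ} (hv : Measurable v) (hg : Measurable g) {M C P c ρ : ℝ}
    (hvM : ∀ t, |v t| ≤ M) (hgM : ∀ t, |g t| ≤ M) (hgs : ∀ t, ρ ≤ |t - c| → g t = 0)
    (hlip : ∀ s ∈ Icc (c - 2 * ρ) (c + 2 * ρ), ∀ t ∈ Icc (c - 2 * ρ) (c + 2 * ρ),
      |v t - v s| ≤ C * |t - s|)
    (hP : ∀ h, 0 < h → ∫ t, |g (t + h) - g t| ≤ P * h) (hC : 0 ≤ C) {a : ℝ} (ha : 0 < a)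
    (haρ : a ≤ ρ) :
    |(∫ h in (-a)..a, ∫ t, v (t + h) * g t) - 2 * a * ∫ t, v t * g t| ≤ C * P * a ^ 3 := by
  have hM : 0 ≤ M := (abs_nonneg _).trans (hvM 0)
  have hgi : Integrable g := by
    rw [← integrableOn_iff_integrable_of_support_subset (s := Icc (c - ρ) (c + ρ))]
    · refine IntegrableOn.of_bound measure_Icc_lt_top hg.aestronglyMeasurable M
        (Filter.Eventually.of_forall hgM)
    · intro t ht
      by_contra h
      refine ht (hgs t ?_)
      by_contra h'
      rw [not_le, abs_lt] at h'
      exact h ⟨by linarith [h'.1], by linarith [h'.2]⟩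
  have hvg : ∀ h k : ℝ, Integrable fun t => v (t + h) * g (t + k) := fun h k =>
    (hgi.comp_add_right k).bdd_mul (c := M)
      (hv.comp (measurable_add_const h)).aestronglyMeasurable
      (Filter.Eventually.of_forall fun t => hvM _)
  set q : ℝ → ℝ := fun h => ∫ t, v (t + h) * g t with hq
  have hqm : StronglyMeasurable q := by
    have : Measurable fun p : ℝ × ℝ => v (p.2 + p.1) * g p.2 := by fun_prop
    exact this.stronglyMeasurable.integral_prod_right'
  have hqb : ∀ h, ‖q h‖ ≤ M * ∫ t, |g t| := fun h => by
    rw [← integral_const_mul]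
    refine norm_integral_le_of_norm_le (hgi.abs.const_mul M)
      (Filter.Eventually.of_forall fun t => ?_)
    rw [norm_mul]
    exact mul_le_mul_of_nonneg_right (hvM _) (abs_nonneg _)
  have hqi : ∀ x y, IntervalIntegrable q volume x y := fun x y =>
    ⟨IntegrableOn.of_bound measure_Ioc_lt_top hqm.aestronglyMeasurable _
      (Filter.Eventually.of_forall hqb), IntegrableOn.of_bound measure_Ioc_lt_top
      hqm.aestronglyMeasurable _ (Filter.Eventually.of_forall hqb)⟩
  have hqi' : IntervalIntegrable (fun h => q (-h)) volume 0 a := by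
    refine ⟨?_, ?_⟩ <;> exact IntegrableOn.of_bound measure_Ioc_lt_top
      (hqm.comp_measurable measurable_neg).aestronglyMeasurable _
      (Filter.Eventually.of_forall fun h => hqb _)
  have hsplit : ∫ h in (-a)..a, q h = ∫ h in (0 : ℝ)..a, (q h + q (-h)) := by
    rw [intervalIntegral.integral_add (hqi 0 a) hqi', intervalIntegral.integral_comp_neg, neg_zero,
      add_comm, intervalIntegral.integral_add_adjacent_intervals (hqi _ _) (hqi _ _)]
  have hpt : ∀ h, 0 < h → h ≤ a → |q h + q (-h) - 2 * q 0| ≤ C * P * a ^ 2 := fun h hh hha => by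
    have h1 : q (-h) = ∫ t, v (t + 0) * g (t + h) := by
      rw [hq]
      dsimp only
      rw [← integral_add_right_eq_self (fun t => v (t + -h) * g t) h]
      simp
    have h2 : q 0 = ∫ t, v (t + h) * g (t + h) := by
      rw [hq]
      dsimp only
      rw [← integral_add_right_eq_self (fun t => v (t + 0) * g t) h]
      simp
    have h3 : q h + q (-h) - 2 * q 0 = - ∫ t, (v (t + h) - v t) * (g (t + h) - g t) := by
      have e : ∀ t, (v (t + h) - v t) * (g (t + h) - g t) =
          v (t + h) * g (t + h) + v (t + 0) * g (t + 0) -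
            (v (t + h) * g (t + 0) + v (t + 0) * g (t + h)) := fun t => by simp; ring
      simp_rw [e]
      rw [integral_sub (f := fun t => v (t + h) * g (t + h) + v (t + 0) * g (t + 0))
        (g := fun t => v (t + h) * g (t + 0) + v (t + 0) * g (t + h))
        ((hvg h h).add (hvg 0 0)) ((hvg h 0).add (hvg 0 h)),
        integral_add (hvg h h) (hvg 0 0), integral_add (hvg h 0) (hvg 0 h), ← h2, ← h1]
      simp only [add_zero, hq]
      ring
    rw [h3, abs_neg]
    have h4 : |∫ t, (v (t + h) - v t) * (g (t + h) - g t)| ≤ ∫ t, C * h * |g (t + h) - g t| := by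
      refine norm_integral_le_of_norm_le (f := fun t => (v (t + h) - v t) * (g (t + h) - g t))
        ?_ (Filter.Eventually.of_forall fun t => ?_)
      · exact (((hgi.comp_add_right h).sub hgi).abs).const_mul _
      · rw [Real.norm_eq_abs, abs_mul]
        by_cases hz : g (t + h) = 0 ∧ g t = 0
        · simp [hz.1, hz.2]
        · gcongr
          have h5 : |t + h - c| < ρ ∨ |t - c| < ρ := by
            by_contra h6
            rw [not_or, not_lt, not_lt] at h6
            exact hz ⟨hgs _ h6.1, hgs _ h6.2⟩
          have h7 := hlip t ?_ (t + h) ?_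
          · rwa [add_sub_cancel_left, abs_of_pos hh] at h7
          all_goals
            rcases h5 with h5 | h5 <;> rw [abs_lt] at h5 <;> constructor <;>
              linarith [h5.1, h5.2]
    rw [integral_const_mul] at h4
    have hPh := hP h hh
    have hP0 : 0 ≤ P * h := (integral_nonneg fun t => abs_nonneg _).trans hPh
    have hP1 : 0 ≤ P := nonneg_of_mul_nonneg_left hP0 hh
    calc _ ≤ C * h * (P * h) := h4.trans (by gcongr)
      _ = C * P * h ^ 2 := by ring
      _ ≤ C * P * a ^ 2 := by gcongr
  have hconst : 2 * a * ∫ t, v t * g t = ∫ h in (0 : ℝ)..a, 2 * q 0 := by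
    simp [hq]; ring
  rw [hconst, hsplit, ← intervalIntegral.integral_sub ((hqi 0 a).add hqi') (by simp)]
  have := intervalIntegral.norm_integral_le_of_norm_le_const (a := 0) (b := a)
    (f := fun h => q h + q (-h) - 2 * q 0) (C := C * P * a ^ 2) fun h hh => by
      rw [uIoc_of_le ha.le] at hh
      exact hpt h hh.1 hh.2
  rw [sub_zero, abs_of_pos ha] at this
  calc _ ≤ _ := this
    _ = _ := by ring

end OneVariable

section Marginals

theorem margInd_eq (E : Set (EuclideanSpace ℝ (Fin 2))) (θ t : ℝ) :
    margInd E θ t = (slice E θ t).toReal := rfl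

theorem measurableSet_slice {E : Set (EuclideanSpace ℝ (Fin 2))} (hE : MeasurableSet E)
    (θ t : ℝ) : MeasurableSet {s : ℝ | rot θ t s ∈ E} :=
  ((continuous_rot θ).measurable.comp measurable_prodMk_left) hE

theorem proj_mem_closure_Asupp {E : Set (EuclideanSpace ℝ (Fin 2))} (hE : MeasurableSet E)
    (hEb : Bornology.IsBounded E) (θ : ℝ) {x : EuclideanSpace ℝ (Fin 2)}
    (hx : x ∈ (volume.restrict E).support) : proj θ x ∈ closure (Asupp E θ) := by
  rw [Metric.mem_closure_iff]
  intro r hr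
  have hpos := (Measure.mem_support_iff_forall x).1 hx _ (Metric.ball_mem_nhds x hr)
  rw [Measure.restrict_apply Metric.isOpen_ball.measurableSet] at hpos
  have hm : MeasurableSet (Metric.ball x r ∩ E) := Metric.isOpen_ball.measurableSet.inter hE
  obtain ⟨t, ht⟩ : ∃ t, slice (Metric.ball x r ∩ E) θ t ≠ 0 := by
    by_contra! h
    have := lintegral_mul_slice hm θ (f := 1) measurable_one
    simp only [h, mul_zero, lintegral_zero, Pi.one_apply, lintegral_one, Measure.restrict_apply,
      MeasurableSet.univ, univ_inter] at this
    exact hpos.ne this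
  obtain ⟨s, hs⟩ := nonempty_of_measure_ne_zero ht
  obtain ⟨R, hR⟩ := hEb.subset_ball 0
  refine ⟨t, ?_, ?_⟩
  · refine ENNReal.toReal_pos ?_
      ((slice_le_of_subset_ball hR θ t).trans_lt ENNReal.ofReal_lt_top).ne
    exact fun h => ht (measure_mono_null (fun s hs => hs.2) h)
  · have h1 := abs_proj_le θ (rot θ t s - x)
    rw [proj_sub, proj_rot, ← dist_eq_norm] at h1
    rw [dist_comm]
    exact h1.trans_lt hs.1

theorem isLinearMap_proj (θ : ℝ) : IsLinearMap ℝ (proj θ) :=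
  ⟨fun x y => by simp [proj]; ring, fun c x => by simp [proj]; ring⟩

theorem Ioo_subset_Asupp {E : Set (EuclideanSpace ℝ (Fin 2))} (hE : MeasurableSet E)
    (hEb : Bornology.IsBounded E) {θ : ℝ} (hA : Convex ℝ (Asupp E θ))
    {x : EuclideanSpace ℝ (Fin 2)} {r : ℝ}
    (hx : Metric.ball x r ⊆ convexHull ℝ (volume.restrict E).support) :
    Ioo (proj θ x - r) (proj θ x + r) ⊆ Asupp E θ := by
  have hsub : convexHull ℝ (volume.restrict E).support ⊆ proj θ ⁻¹' closure (Asupp E θ) :=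
    convexHull_min (fun y hy => proj_mem_closure_Asupp hE hEb θ hy)
      (hA.closure.is_linear_preimage (isLinearMap_proj θ))
  have hcl : ∀ τ, |τ| < r → proj θ x + τ ∈ closure (Asupp E θ) := fun τ hτ => by
    have h1 : x + rot θ τ 0 ∈ Metric.ball x r := by
      rwa [mem_ball_iff_norm, add_sub_cancel_left, norm_rot_zero_right]
    have h2 := hsub (hx h1)
    rwa [mem_preimage, (isLinearMap_proj θ).map_add, proj_rot] at h2
  intro t ⟨ht₁, ht₂⟩
  have hr : 0 < r := by linarith
  have h1 := hcl ((t - r - proj θ x) / 2) (abs_lt.2 ⟨by linarith, by linarith⟩)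
  have h2 := hcl ((t + r - proj θ x) / 2) (abs_lt.2 ⟨by linarith, by linarith⟩)
  obtain ⟨a, ha, ha'⟩ := mem_closure_iff.1 h1 (Iio t) isOpen_Iio
    (by rw [mem_Iio]; linarith)
  obtain ⟨b, hb, hb'⟩ := mem_closure_iff.1 h2 (Ioi t) isOpen_Ioi
    (by rw [mem_Ioi]; linarith)
  exact hA.ordConnected.out ha' hb' ⟨le_of_lt ha, le_of_lt hb⟩

theorem exists_margInd_lipschitz {E : Set (EuclideanSpace ℝ (Fin 2))} (hE : MeasurableSet E)
    (hEb : Bornology.IsBounded E)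
    (hconv : ∀ᵐ θ ∂(volume.restrict (Icc (0 : ℝ) π)),
      Convex ℝ (Asupp E θ) ∧
      ∀ t ∈ interior (Asupp E θ), ∃ ε > (0 : ℝ), ∃ K : NNReal,
        LipschitzOnWith K (margInd E θ) (Metric.ball t ε))
    (hlip : ∀ δ > (0 : ℝ), ∃ C : ℝ,
      ∀ᵐ θ ∂(volume.restrict (Icc (0 : ℝ) π)),
        ∀ᵐ t ∂(volume.restrict {t ∈ Asupp E θ | δ ≤ Metric.infDist t (Asupp E θ)ᶜ}),
          |deriv (margInd E θ) t| ≤ C)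
    {x : EuclideanSpace ℝ (Fin 2)} {δ : ℝ} (hδ : 0 < δ)
    (hx : Metric.ball x (2 * δ) ⊆ convexHull ℝ (volume.restrict E).support) :
    ∃ C : ℝ, 0 ≤ C ∧ ∀ᵐ θ ∂(volume.restrict (Icc (0 : ℝ) π)),
      ∀ s ∈ Icc (proj θ x - δ) (proj θ x + δ), ∀ t ∈ Icc (proj θ x - δ) (proj θ x + δ),
        |margInd E θ t - margInd E θ s| ≤ C * |t - s| := by
  obtain ⟨C, hC⟩ := hlip δ hδ
  refine ⟨max C 0, le_max_right _ _, ?_⟩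
  filter_upwards [hC, hconv] with θ hθ ⟨hA, hloc⟩ s hs t ht
  have hI := Ioo_subset_Asupp hE hEb hA hx
  have hsub : Icc (proj θ x - δ) (proj θ x + δ) ⊆ Ioo (proj θ x - 2 * δ) (proj θ x + 2 * δ) :=
    Icc_subset_Ioo (by linarith) (by linarith)
  obtain ⟨R, hR⟩ := hEb.subset_ball 0
  have hne : (Asupp E θ)ᶜ.Nonempty := by
    refine ⟨R, fun h => ?_⟩
    have h0 : slice E θ R = 0 := slice_eq_zero_of_proj (c := 0) (r := R)
      (fun y hy => by
        rw [sub_zero]; exact (abs_proj_le θ y).trans_lt (mem_ball_zero_iff.1 (hR hy)))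
      (by rw [sub_zero]; exact le_abs_self R)
    have h1 : 0 < margInd E θ R := h
    rw [margInd_eq, h0] at h1
    simp at h1
  refine (abs_sub_le_of_ae_abs_deriv_le (C := C) (fun t ht => hloc t ?_) ?_ hs ht).trans
    (by gcongr; exact le_max_left _ _)
  · exact interior_maximal hI isOpen_Ioo (hsub ht)
  · have hsub' : Icc (proj θ x - δ) (proj θ x + δ) ⊆
        {t ∈ Asupp E θ | δ ≤ Metric.infDist t (Asupp E θ)ᶜ} := by
      refine fun t ht => ⟨hI (hsub ht), (Metric.le_infDist hne).2 fun y hy => ?_⟩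
      rw [Real.dist_eq]
      by_contra h
      rw [not_le, abs_lt] at h
      exact hy (hI ⟨by linarith [ht.1], by linarith [ht.2]⟩)
    exact ae_mono (Measure.restrict_mono hsub' le_rfl) hθ

theorem abs_sqrt_sub_sqrt_le {R s t : ℝ} (hR : 0 < R) (hs : |s| ≤ R / 2) (ht : |t| ≤ R / 2) :
    |√(R ^ 2 - t ^ 2) - √(R ^ 2 - s ^ 2)| ≤ |t - s| := by
  have key : ∀ u, |u| ≤ R / 2 → R / 2 ≤ √(R ^ 2 - u ^ 2) ∧
      √(R ^ 2 - u ^ 2) ^ 2 = R ^ 2 - u ^ 2 := fun u hu => by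
    have : u ^ 2 ≤ (R / 2) ^ 2 := sq_le_sq' (by linarith [(abs_le.1 hu).1]) (abs_le.1 hu).2
    exact ⟨Real.le_sqrt_of_sq_le (by nlinarith), Real.sq_sqrt (by nlinarith)⟩
  obtain ⟨h1, h2⟩ := key t ht
  obtain ⟨h3, h4⟩ := key s hs
  have h5 : (√(R ^ 2 - t ^ 2) - √(R ^ 2 - s ^ 2)) * (√(R ^ 2 - t ^ 2) + √(R ^ 2 - s ^ 2)) =
      (s - t) * (s + t) := by linear_combination h2 - h4
  have h6 := congrArg abs h5
  rw [abs_mul, abs_mul, abs_sub_comm s t] at h6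
  have h7 : R ≤ |√(R ^ 2 - t ^ 2) + √(R ^ 2 - s ^ 2)| := by
    rw [abs_of_nonneg (by positivity)]; linarith
  have h8 : |s + t| ≤ R := (abs_add_le s t).trans (by linarith)
  refine le_of_mul_le_mul_right ?_ hR
  calc _ ≤ _ := mul_le_mul_of_nonneg_left h7 (abs_nonneg _)
    _ = _ := h6
    _ ≤ _ := mul_le_mul_of_nonneg_left h8 (abs_nonneg _)

theorem slice_ball_diff_toReal {E : Set (EuclideanSpace ℝ (Fin 2))} (hE : MeasurableSet E) {R : ℝ}
    (hR : 0 < R) (hER : E ⊆ Metric.ball 0 R) (θ t : ℝ) :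
    (slice (Metric.ball 0 R \ E) θ t).toReal = 2 * √(R ^ 2 - t ^ 2) - margInd E θ t := by
  have hfin : slice E θ t ≠ ⊤ :=
    ((slice_le_of_subset_ball hER θ t).trans_lt ENNReal.ofReal_lt_top).ne
  have h1 : slice (Metric.ball 0 R \ E) θ t = slice (Metric.ball 0 R) θ t - slice E θ t :=
    measure_sdiff (fun s hs => hER hs) (measurableSet_slice hE θ t).nullMeasurableSet hfin
  have h2 : slice E θ t ≤ slice (Metric.ball 0 R) θ t := measure_mono fun s hs => hER hs
  rw [slice_ball hR] at h1 h2
  rw [h1, ENNReal.toReal_sub_of_le h2 ENNReal.ofReal_ne_top,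
    ENNReal.toReal_ofReal (by positivity), margInd_eq]

theorem volume_ball_translate_diff_le (x : EuclideanSpace ℝ (Fin 2)) {r : ℝ} (hr : 0 < r)
    (v : EuclideanSpace ℝ (Fin 2)) :
    volume {y ∈ Metric.ball x r | y + v ∉ Metric.ball x r} ≤
      ENNReal.ofReal (2 * r * (volume.real (Metric.ball (0 : EuclideanSpace ℝ (Fin 2)) 1)) *
        ‖v‖) := by
  set c := volume.real (Metric.ball (0 : EuclideanSpace ℝ (Fin 2)) 1) with hc
  have hvol : ∀ s, 0 ≤ s → volume.real (Metric.ball x s) = s ^ 2 * c := fun s hs => by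
    rw [Measure.real, Measure.addHaar_ball _ _ hs, ENNReal.toReal_mul,
      ENNReal.toReal_ofReal (by positivity), hc, Measure.real]
    simp
  have hc0 : 0 ≤ c := measureReal_nonneg
  set s := max (r - ‖v‖) 0 with hs
  have hs0 : 0 ≤ s := le_max_right _ _
  have hsr : s ≤ r := max_le (by linarith [norm_nonneg v]) hr.le
  have hsub : {y ∈ Metric.ball x r | y + v ∉ Metric.ball x r} ⊆
      Metric.ball x r \ Metric.ball x s := fun y hy => by
    refine ⟨hy.1, fun h => hy.2 ?_⟩
    rw [mem_ball_iff_norm] at h ⊢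
    rcases lt_max_iff.1 h with h | h
    · calc ‖y + v - x‖ = ‖(y - x) + v‖ := by congr 1; abel
        _ ≤ ‖y - x‖ + ‖v‖ := norm_add_le _ _
        _ < r := by linarith
    · exact absurd h (norm_nonneg _).not_gt
  have hdiff : volume.real (Metric.ball x r \ Metric.ball x s) = r ^ 2 * c - s ^ 2 * c := by
    rw [measureReal_sdiff (Metric.ball_subset_ball hsr) Metric.isOpen_ball.measurableSet,
      hvol r hr.le, hvol s hs0]
  refine (measure_mono hsub).trans ?_
  rw [← ENNReal.ofReal_toReal (measure_ne_top_of_subset sdiff_subset measure_ball_lt_top.ne)]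
  refine ENNReal.ofReal_le_ofReal ?_
  change volume.real (Metric.ball x r \ Metric.ball x s) ≤ _
  rw [hdiff]
  have h1 : r - s ≤ ‖v‖ := by linarith [le_max_left (r - ‖v‖) 0]
  have h2 : (r - s) * (r + s) ≤ ‖v‖ * (2 * r) :=
    mul_le_mul h1 (by linarith) (by linarith) (norm_nonneg v)
  nlinarith

theorem exists_volume_inter_ball_translate_diff_le {E : Set (EuclideanSpace ℝ (Fin 2))}
    (hEb : Bornology.IsBounded E) (hEp : HasFinitePerimeter E) (x : EuclideanSpace ℝ (Fin 2))
    {r : ℝ} (hr : 0 < r) :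
    ∃ P : ℝ, 0 ≤ P ∧ ∀ v, volume {y ∈ E ∩ Metric.ball x r | y + v ∉ E ∩ Metric.ball x r} ≤
      ENNReal.ofReal (P * ‖v‖) := by
  obtain ⟨P, hP0, hP⟩ := exists_volume_translate_diff_le hEb hEp
  refine ⟨P + 2 * r * volume.real (Metric.ball (0 : EuclideanSpace ℝ (Fin 2)) 1),
    by positivity, fun v => ?_⟩
  have hsub : {y ∈ E ∩ Metric.ball x r | y + v ∉ E ∩ Metric.ball x r} ⊆
      {y ∈ E | y + v ∉ E} ∪ {y ∈ Metric.ball x r | y + v ∉ Metric.ball x r} := fun y hy => by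
    by_cases h : y + v ∈ E
    · exact Or.inr ⟨hy.1.2, fun h' => hy.2 ⟨h, h'⟩⟩
    · exact Or.inl ⟨hy.1.1, h⟩
  refine ((measure_mono hsub).trans (measure_union_le _ _)).trans ?_
  rw [add_mul, ENNReal.ofReal_add (by positivity) (by positivity)]
  exact add_le_add (hP v) (volume_ball_translate_diff_le x hr v)

theorem integral_abs_slice_sub_le {G : Set (EuclideanSpace ℝ (Fin 2))} (hG : MeasurableSet G)
    (hGb : Bornology.IsBounded G) {P : ℝ} (hP0 : 0 ≤ P)
    (hP : ∀ v, volume {y ∈ G | y + v ∉ G} ≤ ENNReal.ofReal (P * ‖v‖)) (θ : ℝ) {h : ℝ}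
    (hh : 0 < h) :
    ∫ t, |(slice G θ (t + h)).toReal - (slice G θ t).toReal| ≤ 2 * P * h := by
  set v := rot θ h 0 with hv
  have hvn : ‖v‖ = h := by rw [hv, norm_rot_zero_right, abs_of_pos hh]
  have hG' : MeasurableSet {y | y + v ∈ G} := measurable_add_const v hG
  set D₁ := {y ∈ G | y + v ∉ G} with hD₁
  set D₂ := {y | y + v ∈ G ∧ y ∉ G} with hD₂
  have hm₁ : MeasurableSet D₁ := hG.inter hG'.compl
  have hm₂ : MeasurableSet D₂ := hG'.inter hG.compl
  have hvol₁ : volume D₁ ≤ ENNReal.ofReal (P * h) := by simpa [hvn] using hP v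
  have hvol₂ : volume D₂ ≤ ENNReal.ofReal (P * h) := by
    have : D₂ = (fun y => y + v) ⁻¹' {y ∈ G | y + -v ∉ G} := by
      ext y; simp [hD₂]
    rw [this, measure_preimage_add_right]
    simpa [hvn] using hP (-v)
  have hrot : ∀ t s, rot θ (t + h) s = rot θ t s + v := fun t s => by
    rw [hv, ← rot_add, add_zero]
  have hfin : ∀ t, slice G θ t ≠ ⊤ := fun t => by
    obtain ⟨R, hR⟩ := hGb.subset_ball 0
    exact ((slice_le_of_subset_ball hR θ t).trans_lt ENNReal.ofReal_lt_top).ne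
  have hpt : ∀ t, ENNReal.ofReal |(slice G θ (t + h)).toReal - (slice G θ t).toReal| ≤
      1 * slice D₁ θ t + 1 * slice D₂ θ t := fun t => by
    have h1 : slice G θ (t + h) ≤ slice G θ t + slice D₂ θ t := by
      refine (measure_mono fun s hs => ?_).trans (measure_union_le _ _)
      rw [mem_ofPred_eq, hrot] at hs
      by_cases hs' : rot θ t s ∈ G
      · exact Or.inl hs'
      · exact Or.inr ⟨hs, hs'⟩
    have h2 : slice G θ t ≤ slice G θ (t + h) + slice D₁ θ t := by
      refine (measure_mono fun s hs => ?_).trans (measure_union_le _ _)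
      by_cases hs' : rot θ t s + v ∈ G
      · exact Or.inl (by rwa [mem_ofPred_eq, hrot])
      · exact Or.inr ⟨hs, hs'⟩
    rw [one_mul, one_mul]
    rcases le_total (slice G θ t).toReal (slice G θ (t + h)).toReal with h3 | h3
    · rw [abs_of_nonneg (by linarith), ENNReal.ofReal_sub _ ENNReal.toReal_nonneg,
        ENNReal.ofReal_toReal (hfin _), ENNReal.ofReal_toReal (hfin _), tsub_le_iff_left]
      exact h1.trans (by gcongr; exact le_add_self)
    · rw [abs_of_nonpos (by linarith), neg_sub, ENNReal.ofReal_sub _ ENNReal.toReal_nonneg,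
        ENNReal.ofReal_toReal (hfin _), ENNReal.ofReal_toReal (hfin _), tsub_le_iff_left]
      exact h2.trans (by gcongr; exact le_self_add)
  have hms := measurable_slice hG θ
  rw [integral_eq_lintegral_of_nonneg_ae (Filter.Eventually.of_forall fun t => abs_nonneg _)
    (Measurable.aestronglyMeasurable (by fun_prop))]
  refine ENNReal.toReal_le_of_le_ofReal (by positivity) ((lintegral_mono hpt).trans ?_)
  have h₁ := lintegral_mul_slice hm₁ θ (f := 1) measurable_one
  have h₂ := lintegral_mul_slice hm₂ θ (f := 1) measurable_one
  simp only [Pi.one_apply, lintegral_one, Measure.restrict_apply, MeasurableSet.univ,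
    univ_inter] at h₁ h₂
  rw [lintegral_add_left ((measurable_slice hm₁ θ).const_mul 1), h₁, h₂]
  calc _ ≤ ENNReal.ofReal (P * h) + ENNReal.ofReal (P * h) := add_le_add hvol₁ hvol₂
    _ = _ := by rw [← ENNReal.ofReal_add (by positivity) (by positivity)]; ring_nf

end Marginals

section Windows

/-- The measure of the pairs of points of `F × G` whose projections in direction `θ` are at
distance less than `a`. -/
noncomputable def window (F G : Set (EuclideanSpace ℝ (Fin 2))) (θ a : ℝ) : ENNReal :=
  ∫⁻ y in G, volume {x ∈ F | |proj θ x - proj θ y| < a}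

theorem window_le (F G : Set (EuclideanSpace ℝ (Fin 2))) (θ a : ℝ) :
    window F G θ a ≤ volume F * volume G := by
  rw [window, ← setLIntegral_const]
  exact lintegral_mono fun y => measure_mono (sep_subset _ _)

theorem window_eq_lintegral {F G : Set (EuclideanSpace ℝ (Fin 2))} (hF : MeasurableSet F)
    (hG : MeasurableSet G) (θ a : ℝ) :
    window F G θ a = ∫⁻ h in Ioc (-a) a, ∫⁻ t, slice F θ (t + h) * slice G θ t := by
  have hmF := measurable_slice hF θ
  have hmG := measurable_slice hG θ
  have h1 : ∀ τ, volume {x ∈ F | |proj θ x - τ| < a} =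
      ∫⁻ h in Ioc (-a) a, slice F θ (τ + h) := fun τ => by
    have hm : MeasurableSet {x | |proj θ x - τ| < a} :=
      measurableSet_lt (((measurable_proj θ).sub_const τ).norm) measurable_const
    have h2 := lintegral_mul_slice hF θ
      (f := (Ioo (τ - a) (τ + a)).indicator 1) (measurable_one.indicator measurableSet_Ioo)
    have h3 : ∫⁻ x in F, (Ioo (τ - a) (τ + a)).indicator 1 (proj θ x) =
        volume {x ∈ F | |proj θ x - τ| < a} := by
      have h4 : (fun x => (Ioo (τ - a) (τ + a)).indicator (1 : ℝ → ENNReal) (proj θ x)) =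
          {x | |proj θ x - τ| < a}.indicator 1 := by
        ext x
        by_cases h : |proj θ x - τ| < a
        · rw [indicator_of_mem (s := {x | |proj θ x - τ| < a}) h, indicator_of_mem]
          · rfl
          · rw [abs_lt] at h; exact ⟨by linarith [h.1], by linarith [h.2]⟩
        · rw [indicator_of_notMem (s := {x | |proj θ x - τ| < a}) h, indicator_of_notMem]
          exact fun h' => h (abs_lt.2 ⟨by linarith [h'.1], by linarith [h'.2]⟩)
      rw [h4, lintegral_indicator_one hm, Measure.restrict_apply hm, inter_comm]
      rfl
    rw [← h3, ← h2, setLIntegral_congr Ioo_ae_eq_Ioc.symm, ← lintegral_indicator measurableSet_Ioo,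
      ← lintegral_add_left_eq_self _ τ]
    refine lintegral_congr fun h => ?_
    by_cases hh : h ∈ Ioo (-a) a
    · rw [indicator_of_mem hh, indicator_of_mem, Pi.one_apply, one_mul]
      exact ⟨by linarith [hh.1], by linarith [hh.2]⟩
    · rw [indicator_of_notMem hh, indicator_of_notMem, zero_mul]
      exact fun h' => hh ⟨by linarith [h'.1], by linarith [h'.2]⟩
  have hj : Measurable fun p : ℝ × ℝ => slice F θ (p.1 + p.2) :=
    hmF.comp (measurable_fst.add measurable_snd)
  simp_rw [window, h1]
  rw [← lintegral_mul_slice hG θ (f := fun τ => ∫⁻ h in Ioc (-a) a, slice F θ (τ + h))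
    hj.lintegral_prod_right', lintegral_lintegral_swap]
  · refine lintegral_congr fun t => (lintegral_mul_const _ (hmF.comp (measurable_const_add t))).symm
  · exact ((hj.comp measurable_swap).mul (hmG.comp measurable_snd)).aemeasurable

theorem toReal_window {F G : Set (EuclideanSpace ℝ (Fin 2))} (hF : MeasurableSet F)
    (hG : MeasurableSet G) {R : ℝ} (hFR : F ⊆ Metric.ball 0 R) (hGR : G ⊆ Metric.ball 0 R)
    (θ : ℝ) {a : ℝ} (ha : 0 < a) :
    (window F G θ a).toReal =
      ∫ h in (-a)..a, ∫ t, (slice F θ (t + h)).toReal * (slice G θ t).toReal := by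
  have hmF := measurable_slice hF θ
  have hmG := measurable_slice hG θ
  have hfin : ∀ t h, slice F θ (t + h) * slice G θ t < ⊤ := fun t h =>
    ENNReal.mul_lt_top ((slice_le_of_subset_ball hFR θ _).trans_lt ENNReal.ofReal_lt_top)
      ((slice_le_of_subset_ball hGR θ t).trans_lt ENNReal.ofReal_lt_top)
  have hfin' : ∀ h, ∫⁻ t, slice F θ (t + h) * slice G θ t < ⊤ := fun h => by
    have h1 : ∫⁻ t, ENNReal.ofReal (2 * R) * slice G θ t < ⊤ := by
      rw [lintegral_mul_slice hG θ (f := fun _ => ENNReal.ofReal (2 * R)) measurable_const,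
        setLIntegral_const]
      exact ENNReal.mul_lt_top ENNReal.ofReal_lt_top
        ((measure_mono hGR).trans_lt measure_ball_lt_top)
    exact (lintegral_mono fun t => by gcongr; exact slice_le_of_subset_ball hFR θ _).trans_lt h1
  have hj : Measurable fun p : ℝ × ℝ => slice F θ (p.2 + p.1) * slice G θ p.2 :=
    (hmF.comp (measurable_snd.add measurable_fst)).mul (hmG.comp measurable_snd)
  rw [window_eq_lintegral hF hG, intervalIntegral.integral_of_le (by linarith),
    ← integral_toReal hj.lintegral_prod_right'.aemeasurable
      (Filter.Eventually.of_forall hfin')]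
  refine integral_congr_ae (Filter.Eventually.of_forall fun h => ?_)
  simp only [← ENNReal.toReal_mul]
  exact (integral_toReal (hj.comp measurable_prodMk_left).aemeasurable
    (Filter.Eventually.of_forall fun t => hfin t h)).symm

theorem exists_window_le_ten_mul {E : Set (EuclideanSpace ℝ (Fin 2))}
    (hEb : Bornology.IsBounded E) (hEp : HasFinitePerimeter E)
    (hconv : ∀ᵐ θ ∂(volume.restrict (Icc (0 : ℝ) π)),
      Convex ℝ (Asupp E θ) ∧
      ∀ t ∈ interior (Asupp E θ), ∃ ε > (0 : ℝ), ∃ K : NNReal,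
        LipschitzOnWith K (margInd E θ) (Metric.ball t ε))
    (hlip : ∀ δ > (0 : ℝ), ∃ C : ℝ,
      ∀ᵐ θ ∂(volume.restrict (Icc (0 : ℝ) π)),
        ∀ᵐ t ∂(volume.restrict {t ∈ Asupp E θ | δ ≤ Metric.infDist t (Asupp E θ)ᶜ}),
          |deriv (margInd E θ) t| ≤ C)
    {x : EuclideanSpace ℝ (Fin 2)} {ρ R : ℝ} (hρ : 0 < ρ)
    (hx : Metric.ball x (4 * ρ) ⊆ convexHull ℝ (volume.restrict E).support)
    (hER : E ⊆ Metric.ball 0 R) (hxR : ‖x‖ + 2 * ρ ≤ R / 2) :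
    ∃ K : ℝ, 0 ≤ K ∧ ∀ᵐ θ ∂(volume.restrict (Icc (0 : ℝ) π)), ∀ a, 0 < a → a ≤ ρ →
      window (Metric.ball 0 R \ E) (E ∩ Metric.ball x ρ) θ a ≤
        10 * window (Metric.ball 0 R \ E) (E ∩ Metric.ball x ρ) θ (a / 10) +
          ENNReal.ofReal (K * a ^ 3) := by
  have hE := hEp.1
  have hR : 0 < R := by linarith [norm_nonneg x]
  obtain ⟨C, hC0, hC⟩ := exists_margInd_lipschitz hE hEb hconv hlip (δ := 2 * ρ) (by positivity)
    (x := x) (by rwa [← mul_assoc, show (2 : ℝ) * 2 = 4 by norm_num])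
  obtain ⟨P, hP0, hP⟩ := exists_volume_inter_ball_translate_diff_le hEb hEp x hρ
  set F := Metric.ball 0 R \ E with hF
  set G := E ∩ Metric.ball x ρ with hG
  have hFm : MeasurableSet F := Metric.isOpen_ball.measurableSet.diff hE
  have hGm : MeasurableSet G := hE.inter Metric.isOpen_ball.measurableSet
  have hFR : F ⊆ Metric.ball 0 R := sdiff_subset
  have hGR : G ⊆ Metric.ball 0 R := inter_subset_left.trans hER
  refine ⟨2 * ((C + 2) * (2 * P)), by positivity, ?_⟩
  filter_upwards [hC] with θ hθ a ha haρ
  have hle : ∀ {H : Set (EuclideanSpace ℝ (Fin 2))}, H ⊆ Metric.ball 0 R → ∀ t,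
      |(slice H θ t).toReal| ≤ 2 * R := fun hH t => by
    rw [abs_of_nonneg ENNReal.toReal_nonneg]
    exact ENNReal.toReal_le_of_le_ofReal (by positivity) (slice_le_of_subset_ball hH θ t)
  have hpx := abs_proj_le θ x
  have key := fun {b : ℝ} (hb : 0 < b) (hbρ : b ≤ ρ) => abs_correlation_sub_le
    (v := fun t => (slice F θ t).toReal) (g := fun t => (slice G θ t).toReal)
    (measurable_slice hFm θ).ennreal_toReal (measurable_slice hGm θ).ennreal_toReal
    (M := 2 * R) (C := C + 2) (P := 2 * P) (c := proj θ x) (ρ := ρ)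
    (hle hFR) (hle hGR)
    (fun t ht => by
      rw [slice_eq_zero_of_proj (c := proj θ x) (r := ρ) (fun y hy => ?_) ht, ENNReal.toReal_zero]
      rw [← proj_sub]
      exact (abs_proj_le θ _).trans_lt (mem_ball_iff_norm.1 hy.2))
    (fun s hs t ht => by
      have hz : ∀ u ∈ Icc (proj θ x - 2 * ρ) (proj θ x + 2 * ρ), |u| ≤ R / 2 := fun u hu =>
        abs_le.2 ⟨by linarith [hu.1, (abs_le.1 hpx).1], by linarith [hu.2, (abs_le.1 hpx).2]⟩
      have h1 := abs_sqrt_sub_sqrt_le hR (hz s hs) (hz t ht)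
      have h2 := hθ s hs t ht
      rw [slice_ball_diff_toReal hE hR hER, slice_ball_diff_toReal hE hR hER]
      calc _ = |2 * (√(R ^ 2 - t ^ 2) - √(R ^ 2 - s ^ 2)) - (margInd E θ t - margInd E θ s)| := by
            congr 1; ring
        _ ≤ _ := abs_sub _ _
        _ ≤ _ := by rw [abs_mul, abs_two]; linarith)
    (fun h hh => integral_abs_slice_sub_le hGm (hEb.subset inter_subset_left) hP0 hP θ hh)
    (by positivity) hb hbρ
  have k1 := (abs_le.1 (key ha haρ)).2
  have k2 := (abs_le.1 (key (b := a / 10) (by positivity) (by linarith))).1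
  rw [← toReal_window hFm hGm hFR hGR θ ha] at k1
  rw [← toReal_window hFm hGm hFR hGR θ (by positivity)] at k2
  have hfin : ∀ b, window F G θ b ≠ ⊤ := fun b => ((window_le F G θ b).trans_lt
    (ENNReal.mul_lt_top ((measure_mono hFR).trans_lt measure_ball_lt_top)
      ((measure_mono hGR).trans_lt measure_ball_lt_top))).ne
  rw [← ENNReal.ofReal_toReal (hfin a), ← ENNReal.ofReal_toReal (hfin (a / 10)),
    show (10 : ENNReal) = ENNReal.ofReal 10 by simp, ← ENNReal.ofReal_mul (by norm_num),
    ← ENNReal.ofReal_add (by positivity) (by positivity)]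
  refine ENNReal.ofReal_le_ofReal ?_
  have h3 : 0 ≤ (C + 2) * (2 * P) * a ^ 3 := by positivity
  have h4 : (a / 10) ^ 3 = a ^ 3 / 1000 := by ring
  rw [h4] at k2
  linarith

end Windows

section Kernel

/-- The measure of the directions `θ ∈ [0, π]` in which the projection of `z` is less than `a`. -/
noncomputable def dirMeasure (a : ℝ) (z : EuclideanSpace ℝ (Fin 2)) : ENNReal :=
  volume.restrict (Icc 0 π) {θ | |proj θ z| < a}

theorem abs_cos_lt_iff {X θ : ℝ} (hX : X ≤ 1) (hX0 : 0 ≤ X) (hθ : θ ∈ Icc 0 π) :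
    |cos θ| < X ↔ θ ∈ Ioo (arccos X) (π - arccos X) := by
  have key : ∀ φ ∈ Icc 0 π, (cos φ < X ↔ arccos X < φ) := fun φ hφ => by
    have h1 := strictAntiOn_cos.lt_iff_gt hφ ⟨arccos_nonneg X, arccos_le_pi X⟩
    rwa [cos_arccos (by linarith) hX] at h1
  have h2 := key (π - θ) ⟨by linarith [hθ.2], by linarith [hθ.1]⟩
  rw [cos_pi_sub] at h2
  rw [abs_lt, neg_lt, and_comm, key θ hθ, h2, mem_Ioo, lt_sub_comm]

theorem dirMeasure_eq {a : ℝ} (ha : 0 < a) {z : EuclideanSpace ℝ (Fin 2)} (hz : a ≤ ‖z‖) :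
    dirMeasure a z = ENNReal.ofReal (2 * arcsin (a / ‖z‖)) := by
  set r := ‖z‖ with hr
  have hr0 : 0 < r := ha.trans_le hz
  set X := a / r with hX
  have hX1 : X ≤ 1 := (div_le_one hr0).2 hz
  have hX0 : 0 < X := by positivity
  obtain ⟨α, h0, h1⟩ : ∃ α, z 0 = r * cos α ∧ z 1 = r * sin α := by
    have hn : ‖(⟨z 0, z 1⟩ : ℂ)‖ = r := by
      rw [hr, EuclideanSpace.norm_eq, Complex.norm_def, Complex.normSq_mk]
      simp [Fin.sum_univ_two, pow_two]
    exact ⟨Complex.arg ⟨z 0, z 1⟩, by rw [← hn, Complex.norm_mul_cos_arg],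
      by rw [← hn, Complex.norm_mul_sin_arg]⟩
  have hp : ∀ θ, |proj θ z| < a ↔ |cos (θ - α)| < X := fun θ => by
    rw [proj, h0, h1, cos_sub, hX, lt_div_iff₀ hr0, ← abs_of_pos hr0, ← abs_mul, abs_of_pos hr0]
    ring_nf
  set S := {θ : ℝ | |cos θ| < X} with hS
  have hSm : MeasurableSet S := measurableSet_lt continuous_cos.abs.measurable measurable_const
  have hper : Function.Periodic (S.indicator (1 : ℝ → ℝ)) π := fun θ => by
    simp [S, indicator, cos_add_pi, abs_neg]
  have hT : {θ | |proj θ z| < a} = (fun θ => θ - α) ⁻¹' S := by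
    ext θ; exact hp θ
  have hTm : MeasurableSet {θ | |proj θ z| < a} := hT ▸ (measurable_sub_const α) hSm
  have e1 : (dirMeasure a z).toReal = ∫ θ in (0 : ℝ)..π, S.indicator (1 : ℝ → ℝ) (θ - α) := by
    rw [intervalIntegral.integral_of_le pi_pos.le, ← integral_Icc_eq_integral_Ioc]
    have : (fun θ => S.indicator (1 : ℝ → ℝ) (θ - α)) =
        {θ | |proj θ z| < a}.indicator (1 : ℝ → ℝ) := by
      rw [hT]; rfl
    rw [this, integral_indicator_one hTm]; rfl
  have e2 : ∫ θ in (0 : ℝ)..π, S.indicator (1 : ℝ → ℝ) (θ - α) =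
      ∫ θ in (0 : ℝ)..π, S.indicator (1 : ℝ → ℝ) θ := by
    rw [intervalIntegral.integral_comp_sub_right (fun θ => S.indicator (1 : ℝ → ℝ) θ) α]
    have := hper.intervalIntegral_add_eq (0 - α) 0
    rw [zero_add] at this
    rw [← this]; congr 1; ring
  have e3 : ∫ θ in (0 : ℝ)..π, S.indicator (1 : ℝ → ℝ) θ = 2 * arcsin X := by
    rw [intervalIntegral.integral_of_le pi_pos.le, ← integral_Icc_eq_integral_Ioc,
      integral_indicator_one hSm, measureReal_restrict_apply hSm]
    have : S ∩ Icc 0 π = Ioo (arccos X) (π - arccos X) := by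
      ext θ
      constructor
      · exact fun h => (abs_cos_lt_iff hX1 hX0.le h.2).1 h.1
      · intro h
        have hm : θ ∈ Icc 0 π :=
          ⟨(arccos_nonneg X).trans h.1.le, h.2.le.trans (by linarith [arccos_nonneg X])⟩
        exact ⟨(abs_cos_lt_iff hX1 hX0.le hm).2 h, hm⟩
    have h5 : 0 ≤ arcsin X := arcsin_nonneg.2 hX0.le
    rw [this, Real.volume_real_Ioo_of_le (by rw [arccos]; linarith), arccos]
    ring
  have hfin : dirMeasure a z ≠ ⊤ := measure_ne_top _ _
  rw [← ENNReal.ofReal_toReal hfin, e1, e2, e3]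

theorem ten_mul_arcsin_add_le {X : ℝ} (hX0 : 0 < X) (hX : X ≤ 1 / 2) :
    10 * (2 * arcsin (X / 10)) + X ^ 3 / 10 ≤ 2 * arcsin X := by
  have bound : ∀ {Y : ℝ}, 0 < Y → Y ≤ 1 / 2 → 0 < arcsin Y ∧ arcsin Y ≤ 1 ∧
      sin (arcsin Y) = Y := fun {Y} h0 h1 => by
    refine ⟨arcsin_pos.2 h0, ?_, sin_arcsin (by linarith) (by linarith)⟩
    have h2 : arcsin Y ≤ π / 6 := by
      rw [arcsin_le_iff_le_sin' ⟨by linarith [pi_pos], by linarith [pi_pos]⟩, sin_pi_div_six]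
      exact h1
    linarith [pi_lt_d2]
  obtain ⟨hy0, hy1, hy⟩ := bound hX0 hX
  obtain ⟨hz0, hz1, hz⟩ := bound (Y := X / 10) (by positivity) (by linarith)
  set y := arcsin X
  set z := arcsin (X / 10)
  have h1 := (abs_le.1 (sin_bound (x := y) (by rwa [abs_of_pos hy0]))).2
  have h2 := sin_gt_sub_cube hz0
  rw [hy, abs_of_pos hy0] at h1
  rw [hz] at h2
  have h3 : X ≤ y := hy ▸ (sin_lt hy0).le
  have h4 : y ^ 5 ≤ y ^ 3 := pow_le_pow_of_le_one hy0.le hy1 (by norm_num)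
  have h5 : X ^ 3 ≤ y ^ 3 := by gcongr
  have h6 : z ^ 3 ≤ z := pow_le_of_le_one hz0.le hz1 (by norm_num)
  have h7 : z ≤ X * (6 / 40) := by linarith
  have h8 : z ^ 3 ≤ (X * (6 / 40)) ^ 3 := by gcongr
  have h9 : (X * (6 / 40)) ^ 3 = X ^ 3 * (27 / 8000) := by ring
  have h10 : 0 < X ^ 3 := by positivity
  linarith

theorem ten_mul_dirMeasure_add_le {a : ℝ} (ha : 0 < a) {z : EuclideanSpace ℝ (Fin 2)}
    (hz : 2 * a ≤ ‖z‖) :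
    10 * dirMeasure (a / 10) z + ENNReal.ofReal ((a / ‖z‖) ^ 3 / 10) ≤ dirMeasure a z := by
  have hz0 : 0 < ‖z‖ := by linarith
  have hX0 : 0 < a / ‖z‖ := by positivity
  rw [dirMeasure_eq ha (by linarith), dirMeasure_eq (by positivity) (by linarith),
    show (10 : ENNReal) = ENNReal.ofReal 10 by simp, ← ENNReal.ofReal_mul (by norm_num),
    ← ENNReal.ofReal_add _ (by positivity)]
  · refine ENNReal.ofReal_le_ofReal ?_
    rw [show a / 10 / ‖z‖ = a / ‖z‖ / 10 by ring]
    refine ten_mul_arcsin_add_le hX0 ?_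
    rw [div_le_iff₀ hz0]; linarith
  · have : 0 ≤ arcsin (a / 10 / ‖z‖) := arcsin_nonneg.2 (by positivity)
    positivity

theorem dirMeasure_le (a : ℝ) (z : EuclideanSpace ℝ (Fin 2)) :
    dirMeasure a z ≤ ENNReal.ofReal π := by
  refine (measure_mono (subset_univ _)).trans ?_
  rw [Measure.restrict_apply_univ, Real.volume_Icc, sub_zero]

end Kernel

section Energy

/-- The measure of the points `y ∈ G` such that `y + z ∈ F`. -/
noncomputable def pairMeasure (F G : Set (EuclideanSpace ℝ (Fin 2)))
    (z : EuclideanSpace ℝ (Fin 2)) : ENNReal :=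
  volume {y ∈ G | y + z ∈ F}

theorem pairMeasure_eq_lintegral {F : Set (EuclideanSpace ℝ (Fin 2))} (hF : MeasurableSet F)
    (G : Set (EuclideanSpace ℝ (Fin 2))) (z : EuclideanSpace ℝ (Fin 2)) :
    pairMeasure F G z =
      ∫⁻ y in G, F.indicator (1 : EuclideanSpace ℝ (Fin 2) → ENNReal) (y + z) := by
  have hm : MeasurableSet ((fun y => y + z) ⁻¹' F) := measurable_add_const z hF
  have h : (fun y => F.indicator (1 : EuclideanSpace ℝ (Fin 2) → ENNReal) (y + z)) =
      ((fun y => y + z) ⁻¹' F).indicator 1 := rfl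
  rw [h, lintegral_indicator_one hm, Measure.restrict_apply hm, inter_comm]
  rfl

theorem measurable_pairMeasure {F : Set (EuclideanSpace ℝ (Fin 2))} (hF : MeasurableSet F)
    (G : Set (EuclideanSpace ℝ (Fin 2))) : Measurable (pairMeasure F G) := by
  rw [funext (pairMeasure_eq_lintegral hF G)]
  exact Measurable.lintegral_prod_right'
    (f := fun p : EuclideanSpace ℝ (Fin 2) × EuclideanSpace ℝ (Fin 2) =>
      F.indicator (1 : EuclideanSpace ℝ (Fin 2) → ENNReal) (p.2 + p.1))
    ((measurable_one.indicator hF).comp (measurable_snd.add measurable_fst))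

theorem lintegral_lintegral_sub {F G : Set (EuclideanSpace ℝ (Fin 2))} (hF : MeasurableSet F)
    {φ : EuclideanSpace ℝ (Fin 2) → ENNReal} (hφ : Measurable φ) :
    ∫⁻ y in G, ∫⁻ x in F, φ (x - y) = ∫⁻ z, φ z * pairMeasure F G z := by
  have h1 : ∀ y, ∫⁻ x in F, φ (x - y) =
      ∫⁻ z, φ z * F.indicator (1 : EuclideanSpace ℝ (Fin 2) → ENNReal) (y + z) := fun y => by
    rw [← lintegral_indicator hF, ← lintegral_add_left_eq_self _ y]
    refine lintegral_congr fun z => ?_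
    by_cases h : y + z ∈ F
    · rw [indicator_of_mem h, indicator_of_mem h, add_sub_cancel_left, Pi.one_apply, mul_one]
    · rw [indicator_of_notMem h, indicator_of_notMem h, mul_zero]
  have hm : Measurable fun p : EuclideanSpace ℝ (Fin 2) × EuclideanSpace ℝ (Fin 2) =>
      F.indicator (1 : EuclideanSpace ℝ (Fin 2) → ENNReal) (p.1 + p.2) :=
    (measurable_one.indicator hF).comp (measurable_fst.add measurable_snd)
  simp_rw [h1]
  rw [lintegral_lintegral_swap ((hφ.comp measurable_snd).mul hm).aemeasurable]
  refine lintegral_congr fun z => ?_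
  rw [pairMeasure_eq_lintegral hF]
  exact lintegral_const_mul _ (hm.comp measurable_prodMk_right)

theorem measurableSet_abs_proj_sub_lt (a : ℝ) :
    MeasurableSet {p : ℝ × EuclideanSpace ℝ (Fin 2) × EuclideanSpace ℝ (Fin 2) |
      |proj p.1 (p.2.2 - p.2.1)| < a} :=
  measurableSet_lt (continuous_proj.comp (f := fun p : ℝ × EuclideanSpace ℝ (Fin 2) ×
    EuclideanSpace ℝ (Fin 2) => (p.1, p.2.2 - p.2.1)) (by fun_prop)).abs.measurable
    measurable_const

theorem measurable_dirMeasure (a : ℝ) : Measurable (dirMeasure a) := by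
  have hm : MeasurableSet {p : EuclideanSpace ℝ (Fin 2) × ℝ | |proj p.2 p.1| < a} :=
    measurableSet_lt (continuous_proj.comp continuous_swap).abs.measurable measurable_const
  exact measurable_measure_prodMk_left hm

theorem lintegral_window {F G : Set (EuclideanSpace ℝ (Fin 2))} (hF : MeasurableSet F) (a : ℝ) :
    ∫⁻ θ in Icc 0 π, window F G θ a = ∫⁻ z, dirMeasure a z * pairMeasure F G z := by
  set T := {p : ℝ × EuclideanSpace ℝ (Fin 2) × EuclideanSpace ℝ (Fin 2) |
      |proj p.1 (p.2.2 - p.2.1)| < a} with hT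
  have hTm : MeasurableSet T := measurableSet_abs_proj_sub_lt a
  set f : ℝ × EuclideanSpace ℝ (Fin 2) × EuclideanSpace ℝ (Fin 2) → ENNReal := T.indicator 1
  have hf : Measurable f := measurable_one.indicator hTm
  have h1 : ∀ θ y, volume {x ∈ F | |proj θ x - proj θ y| < a} = ∫⁻ x in F, f (θ, y, x) :=
    fun θ y => by
      have hm : MeasurableSet {x | |proj θ (x - y)| < a} :=
        hTm.preimage (f := fun x => (θ, y, x)) (by fun_prop)
      have h : (fun x => f (θ, y, x)) = {x | |proj θ (x - y)| < a}.indicator 1 := rfl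
      rw [h, lintegral_indicator_one hm, Measure.restrict_apply hm, inter_comm]
      simp_rw [proj_sub]
      rfl
  have h2 : ∀ y x, ∫⁻ θ in Icc 0 π, f (θ, y, x) = dirMeasure a (x - y) := fun y x => by
    have hm : MeasurableSet {θ | |proj θ (x - y)| < a} :=
      hTm.preimage (f := fun θ => (θ, y, x)) (by fun_prop)
    have h : (fun θ => f (θ, y, x)) = {θ | |proj θ (x - y)| < a}.indicator 1 := rfl
    rw [h, lintegral_indicator_one hm]
    rfl
  simp_rw [window, h1]
  rw [lintegral_lintegral_swap, ← lintegral_lintegral_sub hF (measurable_dirMeasure a)]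
  · refine lintegral_congr fun y => ?_
    rw [lintegral_lintegral_swap]
    · exact lintegral_congr fun x => h2 y x
    · exact (hf.comp (by fun_prop : Measurable fun p : ℝ × EuclideanSpace ℝ (Fin 2) =>
        (p.1, y, p.2))).aemeasurable
  · refine (Measurable.lintegral_prod_right' (f := fun p : (ℝ × EuclideanSpace ℝ (Fin 2)) ×
      EuclideanSpace ℝ (Fin 2) => f (p.1.1, p.1.2, p.2)) ?_).aemeasurable
    exact hf.comp (by fun_prop)

theorem exists_lintegral_norm_rpow_mul_pairMeasure_le {F G : Set (EuclideanSpace ℝ (Fin 2))}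
    (hF : MeasurableSet F) {R : ℝ} (hFR : F ⊆ Metric.ball 0 R) (hGR : G ⊆ Metric.ball 0 R)
    (hFG : Disjoint F G) {P : ℝ} (hP0 : 0 ≤ P)
    (hP : ∀ v, volume {y ∈ G | y + v ∉ G} ≤ ENNReal.ofReal (P * ‖v‖)) {K ρ : ℝ} (hK : 0 ≤ K)
    (hW : ∀ᵐ θ ∂(volume.restrict (Icc (0 : ℝ) π)), ∀ a, 0 < a → a ≤ ρ →
      window F G θ a ≤ 10 * window F G θ (a / 10) + ENNReal.ofReal (K * a ^ 3)) :
    ∃ C : ℝ, ∀ a, 0 < a → a ≤ ρ →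
      ∫⁻ z in {z | 2 * a ≤ ‖z‖}, ENNReal.ofReal ((‖z‖ ^ 3)⁻¹) * pairMeasure F G z ≤
        ENNReal.ofReal C := by
  set c := volume.real (Metric.ball (0 : EuclideanSpace ℝ (Fin 2)) 1) with hc
  have hc0 : 0 ≤ c := measureReal_nonneg
  have hπ := pi_pos
  refine ⟨10 * (K * π + 10 * π * (P * 8 * c)), fun a ha haρ => ?_⟩
  set N := pairMeasure F G with hN
  have hNm : Measurable N := measurable_pairMeasure hF G
  set A : Set (EuclideanSpace ℝ (Fin 2)) := {z | 2 * a ≤ ‖z‖} with hA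
  have hAm : MeasurableSet A := measurableSet_le measurable_const measurable_norm
  have hAc : Aᶜ = Metric.ball 0 (2 * a) := by
    ext z; simp [hA]
  have hk := measurable_dirMeasure
  set J := ∫⁻ z in A, ENNReal.ofReal ((‖z‖ ^ 3)⁻¹) * N z with hJ
  set I := fun b : ℝ => ∫⁻ z, dirMeasure b z * N z with hI
  have hIw : ∀ b, I b = ∫⁻ θ in Icc 0 π, window F G θ b := fun b => (lintegral_window hF b).symm
  have hIfin : I (a / 10) ≠ ⊤ := by
    rw [hIw]
    refine ((lintegral_mono fun θ => window_le F G θ _).trans_lt ?_).ne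
    rw [lintegral_const]
    exact ENNReal.mul_lt_top (ENNReal.mul_lt_top
      ((measure_mono hFR).trans_lt measure_ball_lt_top)
      ((measure_mono hGR).trans_lt measure_ball_lt_top)) (measure_lt_top _ _)
  have hIa : I a ≤ 10 * I (a / 10) + ENNReal.ofReal (K * a ^ 3 * π) := by
    calc I a = ∫⁻ θ in Icc 0 π, window F G θ a := hIw a
      _ ≤ ∫⁻ θ in Icc 0 π, (10 * window F G θ (a / 10) + ENNReal.ofReal (K * a ^ 3)) :=
        lintegral_mono_ae (hW.mono fun θ h => h a ha haρ)
      _ = _ := by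
        rw [lintegral_add_right _ measurable_const, lintegral_const_mul' _ _ (by simp), ← hIw,
          lintegral_const, Measure.restrict_apply_univ, Real.volume_Icc, sub_zero,
          ← ENNReal.ofReal_mul (by positivity)]
  have hsmall : ∫⁻ z in Aᶜ, N z ≤ ENNReal.ofReal (P * 8 * c * a ^ 3) := by
    calc ∫⁻ z in Aᶜ, N z ≤ ∫⁻ z in Aᶜ, ENNReal.ofReal (P * (2 * a)) := by
          refine setLIntegral_mono measurable_const fun z hz => ?_
          have hsub : {y ∈ G | y + z ∈ F} ⊆ {y ∈ G | y + z ∉ G} :=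
            fun y hy => ⟨hy.1, fun h => hFG.ne_of_mem hy.2 h rfl⟩
          refine (measure_mono hsub).trans ((hP z).trans ?_)
          rw [hAc, mem_ball_zero_iff] at hz
          gcongr
      _ = _ := by
        rw [setLIntegral_const, hAc, Measure.addHaar_ball _ _ (by positivity),
          ← ENNReal.ofReal_toReal (measure_ball_lt_top
            (μ := (volume : Measure (EuclideanSpace ℝ (Fin 2)))) (x := 0) (r := 1)).ne,
          ← ENNReal.ofReal_mul (by positivity), ← ENNReal.ofReal_mul (by positivity)]
        simp only [finrank_euclideanSpace, Fintype.card_fin]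
        change ENNReal.ofReal (P * (2 * a) * ((2 * a) ^ 2 * c)) = _
        ring_nf
  have hpt : ∀ z, 10 * (dirMeasure (a / 10) z * N z) +
      A.indicator (fun z => ENNReal.ofReal (a ^ 3 / 10) *
        (ENNReal.ofReal ((‖z‖ ^ 3)⁻¹) * N z)) z ≤
      dirMeasure a z * N z + Aᶜ.indicator (fun z => ENNReal.ofReal (10 * π) * N z) z := by
    intro z
    by_cases hz : z ∈ A
    · rw [indicator_of_mem hz, indicator_of_notMem (not_not.2 hz), add_zero, ← mul_assoc,
        ← mul_assoc, ← add_mul, ← ENNReal.ofReal_mul (by positivity)]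
      gcongr
      refine le_trans (le_of_eq ?_) (ten_mul_dirMeasure_add_le ha hz)
      congr 2
      ring
    · rw [indicator_of_notMem hz, indicator_of_mem hz, add_zero, ← mul_assoc]
      refine le_trans ?_ le_add_self
      rw [ENNReal.ofReal_mul (by norm_num), show ENNReal.ofReal 10 = 10 by simp]
      gcongr
      exact dirMeasure_le _ _
  have hkN : ∀ b, Measurable fun z => dirMeasure b z * N z := fun b => (hk b).mul hNm
  have hint := lintegral_mono (μ := volume) hpt
  rw [lintegral_add_left ((hkN _).const_mul _), lintegral_add_left (hkN _),
    lintegral_indicator hAm, lintegral_indicator hAm.compl,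
    lintegral_const_mul' _ _ (by simp), lintegral_const_mul' _ _ ENNReal.ofReal_ne_top,
    lintegral_const_mul' _ _ ENNReal.ofReal_ne_top] at hint
  have h3 : 10 * I (a / 10) + ENNReal.ofReal (a ^ 3 / 10) * J ≤
      10 * I (a / 10) + (ENNReal.ofReal (K * a ^ 3 * π) +
        ENNReal.ofReal (10 * π) * ENNReal.ofReal (P * 8 * c * a ^ 3)) := by
    refine hint.trans ?_
    rw [← add_assoc]
    gcongr
  have h4 := (ENNReal.add_le_add_iff_left (ENNReal.mul_ne_top (by simp) hIfin)).1 h3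
  rw [← ENNReal.ofReal_mul (by positivity), ← ENNReal.ofReal_add (by positivity) (by positivity)]
    at h4
  have ha3 : 0 < a ^ 3 / 10 := by positivity
  refine (ENNReal.mul_le_mul_iff_right (ENNReal.ofReal_pos.2 ha3).ne' ENNReal.ofReal_ne_top).1
    (h4.trans ?_)
  rw [← ENNReal.ofReal_mul ha3.le]
  refine ENNReal.ofReal_le_ofReal (le_of_eq ?_)
  ring

end Energy

section Telescoping

theorem pairMeasure_compl_le_mul {E : Set (EuclideanSpace ℝ (Fin 2))}
    {x : EuclideanSpace ℝ (Fin 2)} {r d ρ R : ℝ} (hd : r + d ≤ ρ)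
    (hR : Metric.ball x ρ ⊆ Metric.ball 0 R) {u : EuclideanSpace ℝ (Fin 2)} (hu : ‖u‖ ≤ d)
    {n : ℕ} (hn : n ≠ 0) :
    pairMeasure Eᶜ (E ∩ Metric.ball x r) u ≤
      n * pairMeasure (Metric.ball 0 R \ E) (E ∩ Metric.ball x ρ) ((n : ℝ)⁻¹ • u) := by
  have hn0 : (0 : ℝ) < n := by positivity
  set w := (n : ℝ)⁻¹ • u with hw
  set D := {y ∈ E ∩ Metric.ball x ρ | y + w ∈ Metric.ball 0 R \ E} with hD
  have hsub : {y ∈ E ∩ Metric.ball x r | y + u ∈ Eᶜ} ⊆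
      ⋃ j ∈ Finset.range n, (fun y => y + (j : ℝ) • w) ⁻¹' D := by
    rintro y ⟨⟨hyE, hyr⟩, hyu⟩
    have hball : ∀ j : ℕ, j ≤ n → y + (j : ℝ) • w ∈ Metric.ball x ρ := fun j hj => by
      rw [mem_ball_iff_norm] at hyr ⊢
      have h1 : ‖(j : ℝ) • w‖ ≤ d := by
        rw [hw, norm_smul, norm_smul, norm_inv, Real.norm_natCast, Real.norm_natCast, ← mul_assoc]
        calc (j : ℝ) * (n : ℝ)⁻¹ * ‖u‖ ≤ 1 * ‖u‖ := by
              gcongr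
              rw [← div_eq_mul_inv]
              exact (div_le_one hn0).2 (by exact_mod_cast hj)
          _ ≤ d := by rwa [one_mul]
      calc ‖y + (j : ℝ) • w - x‖ = ‖(y - x) + (j : ℝ) • w‖ := by congr 1; abel
        _ ≤ ‖y - x‖ + ‖(j : ℝ) • w‖ := norm_add_le _ _
        _ < ρ := by linarith
    obtain ⟨j, hj, hjE, hjE'⟩ : ∃ j < n, y + (j : ℝ) • w ∈ E ∧ y + ((j + 1 : ℕ) : ℝ) • w ∉ E := by
      by_contra! h
      have : ∀ j ≤ n, y + (j : ℝ) • w ∈ E := fun j => by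
        induction j with
        | zero => intro _; simpa using hyE
        | succ j ih => exact fun hj => h j hj (ih (by omega))
      refine hyu ?_
      have h2 := this n le_rfl
      rwa [hw, smul_smul, mul_inv_cancel₀ hn0.ne', one_smul] at h2
    have hadd : y + (j : ℝ) • w + w = y + ((j + 1 : ℕ) : ℝ) • w := by
      push_cast
      rw [add_smul, one_smul, add_assoc]
    refine mem_biUnion (Finset.mem_range.2 hj) ⟨⟨hjE, hball j hj.le⟩, ?_⟩
    rw [hadd]
    exact ⟨hR (hball (j + 1) hj), hjE'⟩
  calc pairMeasure Eᶜ (E ∩ Metric.ball x r) u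
      ≤ volume (⋃ j ∈ Finset.range n, (fun y => y + (j : ℝ) • w) ⁻¹' D) := measure_mono hsub
    _ ≤ ∑ j ∈ Finset.range n, volume ((fun y => y + (j : ℝ) • w) ⁻¹' D) :=
      measure_biUnion_finset_le _ _
    _ = _ := by
      simp_rw [measure_preimage_add_right]
      rw [Finset.sum_const, Finset.card_range, nsmul_eq_mul]
      rfl

/-- The annulus of outer radius `d` and inner radius `d / 2`. -/
def annulus (d : ℝ) : Set (EuclideanSpace ℝ (Fin 2)) :=
  {z | d / 2 < ‖z‖ ∧ ‖z‖ ≤ d}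

theorem measurableSet_annulus (d : ℝ) : MeasurableSet (annulus d) :=
  (measurableSet_lt measurable_const measurable_norm).inter
    (measurableSet_le measurable_norm measurable_const)

theorem lintegral_annulus_le {N N' : EuclideanSpace ℝ (Fin 2) → ENNReal} (hN : Measurable N)
    {d : ℝ} {n : ℕ} (hn : n ≠ 0)
    (hNN : ∀ u, ‖u‖ ≤ d → N' u ≤ n * N ((n : ℝ)⁻¹ • u)) :
    ∫⁻ u in annulus d, ENNReal.ofReal ((‖u‖ ^ 3)⁻¹) * N' u ≤
      ∫⁻ z in annulus (d / n), ENNReal.ofReal ((‖z‖ ^ 3)⁻¹) * N z := by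
  have hn0 : (0 : ℝ) < n := by positivity
  set f : EuclideanSpace ℝ (Fin 2) → ENNReal :=
    (annulus (d / n)).indicator fun z => ENNReal.ofReal ((‖z‖ ^ 3)⁻¹) * N z with hf
  have hfm : Measurable f :=
    Measurable.indicator (by fun_prop) (measurableSet_annulus _)
  have hmap := Measure.map_addHaar_smul (volume : Measure (EuclideanSpace ℝ (Fin 2)))
    (inv_ne_zero hn0.ne')
  have h1 : ∫⁻ u, f ((n : ℝ)⁻¹ • u) = ENNReal.ofReal (n ^ 2) * ∫⁻ z, f z := by
    rw [← lintegral_map (μ := volume) hfm (measurable_const_smul (n : ℝ)⁻¹), hmap,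
      lintegral_smul_measure, finrank_euclideanSpace, Fintype.card_fin, smul_eq_mul,
      inv_pow, inv_inv, abs_of_pos (by positivity)]
  rw [← lintegral_indicator (measurableSet_annulus (d / n)), ← hf,
    ← ENNReal.mul_le_mul_iff_right (ENNReal.ofReal_pos.2 (pow_pos hn0 2)).ne'
      ENNReal.ofReal_ne_top, ← h1, ← lintegral_indicator (measurableSet_annulus d),
    ← lintegral_const_mul' _ _ ENNReal.ofReal_ne_top]
  refine lintegral_mono fun u => ?_
  by_cases hu : u ∈ annulus d
  · have hnorm : ‖(n : ℝ)⁻¹ • u‖ = ‖u‖ / n := by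
      rw [norm_smul, norm_inv, Real.norm_natCast, div_eq_inv_mul]
    have hu' : (n : ℝ)⁻¹ • u ∈ annulus (d / n) := by
      constructor
      · rw [hnorm, div_right_comm]; exact div_lt_div_of_pos_right hu.1 hn0
      · rw [hnorm]; exact div_le_div_of_nonneg_right hu.2 hn0.le
    simp only [hf]
    rw [indicator_of_mem hu, indicator_of_mem hu', hnorm, ← mul_assoc,
      ← ENNReal.ofReal_mul (by positivity)]
    calc _ ≤ ENNReal.ofReal (n ^ 2 * (‖u‖ ^ 3)⁻¹) * (n * N ((n : ℝ)⁻¹ • u)) := by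
          gcongr
          exact hNN u hu.2
      _ = ENNReal.ofReal (n ^ 2 * (‖u‖ ^ 3)⁻¹ * n) * N ((n : ℝ)⁻¹ • u) := by
          rw [ENNReal.ofReal_mul (q := (n : ℝ)) (by positivity), ENNReal.ofReal_natCast, mul_assoc]
      _ = _ := by
          congr 2
          rw [div_pow, inv_div]
          ring
  · rw [indicator_of_notMem hu, mul_zero]
    exact zero_le

theorem ae_eq_zero_of_forall_le {N N' : EuclideanSpace ℝ (Fin 2) → ENNReal} (hN : Measurable N)
    (hN' : Measurable N') {d C : ℝ} (hd : 0 < d)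
    (hNN : ∀ (n : ℕ) u, n ≠ 0 → ‖u‖ ≤ d → N' u ≤ n * N ((n : ℝ)⁻¹ • u))
    (hC : ∀ a, 0 < a → a ≤ d →
      ∫⁻ z in {z | 2 * a ≤ ‖z‖}, ENNReal.ofReal ((‖z‖ ^ 3)⁻¹) * N z ≤ ENNReal.ofReal C) :
    ∀ᵐ u, u ∈ annulus d → N' u = 0 := by
  set I' := ∫⁻ u in annulus d, ENNReal.ofReal ((‖u‖ ^ 3)⁻¹) * N' u with hI'
  have hind : ∀ m : ℕ, m * I' ≤
      ∫⁻ z in {z | d / 2 ^ m < ‖z‖}, ENNReal.ofReal ((‖z‖ ^ 3)⁻¹) * N z := fun m => by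
    induction m with
    | zero => simp
    | succ m ih =>
      have hun : {z : EuclideanSpace ℝ (Fin 2) | d / 2 ^ (m + 1) < ‖z‖} =
          {z | d / 2 ^ m < ‖z‖} ∪ annulus (d / (2 ^ m : ℕ)) := by
        ext z
        have h1 : d / 2 ^ (m + 1) = d / 2 ^ m / 2 := by rw [pow_succ]; ring
        have h2 : 0 < d / 2 ^ m := by positivity
        simp only [mem_union, mem_ofPred_eq, annulus, Nat.cast_pow, Nat.cast_ofNat, h1]
        constructor
        · intro h
          rcases lt_or_ge (d / 2 ^ m) ‖z‖ with h3 | h3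
          · exact Or.inl h3
          · exact Or.inr ⟨h, h3⟩
        · rintro (h | h)
          · linarith
          · exact h.1
      have hdisj : Disjoint {z : EuclideanSpace ℝ (Fin 2) | d / 2 ^ m < ‖z‖}
          (annulus (d / (2 ^ m : ℕ))) := by
        rw [Set.disjoint_left]
        intro z hz hz'
        have h3 := hz'.2
        push_cast at h3
        exact (not_le.2 hz) h3
      rw [hun, lintegral_union (measurableSet_annulus _) hdisj, Nat.cast_succ, add_mul, one_mul]
      exact add_le_add ih (lintegral_annulus_le hN (by positivity)
        fun u hu => hNN _ u (by positivity) hu)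
  have hbd : ∀ m : ℕ, m * I' ≤ ENNReal.ofReal C := fun m => by
    refine (hind m).trans ((lintegral_mono_set fun z hz => ?_).trans
      (hC (d / 2 ^ m / 2) (by positivity) ?_))
    · have : d / 2 ^ m < ‖z‖ := hz
      change 2 * (d / 2 ^ m / 2) ≤ ‖z‖
      linarith
    · rw [div_div]
      exact div_le_self hd.le (by
        have : (1 : ℝ) ≤ 2 ^ m := one_le_pow₀ (by norm_num)
        linarith)
  have hzero : I' = 0 := by
    by_contra h
    obtain ⟨m, hm⟩ := ENNReal.exists_nat_mul_gt h (ENNReal.ofReal_ne_top (r := C))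
    exact absurd (hbd m) (not_le.2 hm)
  have hm : Measurable fun u => ENNReal.ofReal ((‖u‖ ^ 3)⁻¹) * N' u := by fun_prop
  rw [hI', lintegral_eq_zero_iff hm] at hzero
  have := (ae_restrict_iff' (measurableSet_annulus d)).1 hzero
  filter_upwards [this] with u hu hud
  have hpos : 0 < ‖u‖ := lt_trans (by positivity) hud.1
  refine (mul_eq_zero.1 (hu hud)).resolve_left ?_
  exact (ENNReal.ofReal_pos.2 (by positivity)).ne'

theorem volume_inter_ball_eq_zero_or {E : Set (EuclideanSpace ℝ (Fin 2))} (hE : MeasurableSet E)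
    {x : EuclideanSpace ℝ (Fin 2)} {ρ R C : ℝ} (hρ : 0 < ρ)
    (hR : Metric.ball x ρ ⊆ Metric.ball 0 R)
    (hC : ∀ a, 0 < a → a ≤ ρ →
      ∫⁻ z in {z | 2 * a ≤ ‖z‖}, ENNReal.ofReal ((‖z‖ ^ 3)⁻¹) *
        pairMeasure (Metric.ball 0 R \ E) (E ∩ Metric.ball x ρ) z ≤ ENNReal.ofReal C) :
    volume (E ∩ Metric.ball x (ρ / 4)) = 0 ∨ volume (Metric.ball x (ρ / 4) \ E) = 0 := by
  have hN := measurable_pairMeasure (Metric.isOpen_ball.measurableSet.diff hE)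
    (F := Metric.ball 0 R \ E) (E ∩ Metric.ball x ρ)
  have hN' := measurable_pairMeasure hE.compl (E ∩ Metric.ball x (ρ / 4))
  have hann : ∀ᵐ u, ∀ k : ℕ, u ∈ annulus (ρ / 2 / 2 ^ k) →
      pairMeasure Eᶜ (E ∩ Metric.ball x (ρ / 4)) u = 0 := by
    rw [ae_all_iff]
    intro k
    have hk : ρ / 2 / 2 ^ k ≤ ρ / 2 :=
      div_le_self (by positivity) (one_le_pow₀ (by norm_num))
    exact ae_eq_zero_of_forall_le hN hN' (by positivity)
      (fun n u hn hu => pairMeasure_compl_le_mul (d := ρ / 2) (by linarith) hR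
        (hu.trans hk) hn)
      (fun a ha had => hC a ha (by linarith))
  have hball : ∀ᵐ u, (Metric.ball 0 (ρ / 2)).indicator
      (1 : EuclideanSpace ℝ (Fin 2) → ENNReal) u *
        pairMeasure Eᶜ (E ∩ Metric.ball x (ρ / 4)) u = 0 := by
    filter_upwards [hann, compl_mem_ae_iff.2 (measure_singleton (0 : EuclideanSpace ℝ (Fin 2)))]
      with u hu hu0
    by_cases hud : u ∈ Metric.ball 0 (ρ / 2)
    · rw [mem_ball_zero_iff] at hud
      have hu0' : 0 < ‖u‖ := norm_pos_iff.2 hu0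
      obtain ⟨k, hk, hk'⟩ := exists_nat_pow_near_of_lt_one (x := ‖u‖ / (ρ / 2)) (y := (1 / 2 : ℝ))
        (by positivity) ((div_le_one (by positivity)).2 hud.le) (by norm_num) (by norm_num)
      rw [lt_div_iff₀ (by positivity)] at hk
      rw [div_le_iff₀ (by positivity)] at hk'
      rw [hu k ⟨?_, ?_⟩, mul_zero]
      · calc ρ / 2 / 2 ^ k / 2 = (1 / 2) ^ (k + 1) * (ρ / 2) := by
              rw [pow_succ, one_div, inv_pow]; ring
          _ < _ := hk
      · calc ‖u‖ ≤ (1 / 2) ^ k * (ρ / 2) := hk'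
          _ = _ := by rw [one_div, inv_pow]; ring
    · rw [indicator_of_notMem hud, zero_mul]
  have hφ : Measurable ((Metric.ball 0 (ρ / 2)).indicator
      (1 : EuclideanSpace ℝ (Fin 2) → ENNReal)) :=
    measurable_one.indicator Metric.isOpen_ball.measurableSet
  have hint := lintegral_lintegral_sub (G := E ∩ Metric.ball x (ρ / 4)) hE.compl hφ
  rw [lintegral_congr_ae hball, lintegral_zero] at hint
  have hle : volume (Metric.ball x (ρ / 4) \ E) * volume (E ∩ Metric.ball x (ρ / 4)) ≤ 0 := by
    rw [← hint, ← setLIntegral_const]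
    refine setLIntegral_mono' (hE.inter Metric.isOpen_ball.measurableSet) fun y hy => ?_
    have hsub : Metric.ball x (ρ / 4) \ E ⊆ Eᶜ := fun z hz => hz.2
    refine le_trans ?_ (lintegral_mono_set hsub)
    rw [← setLIntegral_one]
    refine setLIntegral_mono' (Metric.isOpen_ball.measurableSet.diff hE) fun z hz => ?_
    rw [indicator_of_mem, Pi.one_apply]
    rw [mem_ball_zero_iff, ← dist_eq_norm]
    have h1 : dist z x < ρ / 4 := hz.1
    have h2 : dist y x < ρ / 4 := hy.2
    linarith [dist_triangle_right z y x]
  exact (mul_eq_zero.1 (nonpos_iff_eq_zero.1 hle)).symm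

end Telescoping

theorem exists_ball_volume_eq_zero_or {E : Set (EuclideanSpace ℝ (Fin 2))}
    (hEb : Bornology.IsBounded E) (hEp : HasFinitePerimeter E)
    (hconv : ∀ᵐ θ ∂(volume.restrict (Icc (0 : ℝ) π)),
      Convex ℝ (Asupp E θ) ∧
      ∀ t ∈ interior (Asupp E θ), ∃ ε > (0 : ℝ), ∃ K : NNReal,
        LipschitzOnWith K (margInd E θ) (Metric.ball t ε))
    (hlip : ∀ δ > (0 : ℝ), ∃ C : ℝ,
      ∀ᵐ θ ∂(volume.restrict (Icc (0 : ℝ) π)),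
        ∀ᵐ t ∂(volume.restrict {t ∈ Asupp E θ | δ ≤ Metric.infDist t (Asupp E θ)ᶜ}),
          |deriv (margInd E θ) t| ≤ C)
    {x : EuclideanSpace ℝ (Fin 2)}
    (hx : x ∈ interior (convexHull ℝ (volume.restrict E).support)) :
    ∃ r > 0, volume (E ∩ Metric.ball x r) = 0 ∨ volume (Metric.ball x r \ E) = 0 := by
  obtain ⟨s, hs, hsx⟩ := Metric.mem_nhds_iff.1 (mem_interior_iff_mem_nhds.1 hx)
  obtain ⟨R₀, hR₀⟩ := hEb.subset_ball 0
  set ρ := s / 4 with hρ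
  have hρ0 : 0 < ρ := by positivity
  set R := max R₀ (2 * (‖x‖ + 2 * ρ)) with hR
  have hER : E ⊆ Metric.ball 0 R := hR₀.trans (Metric.ball_subset_ball (le_max_left _ _))
  have hxR : ‖x‖ + 2 * ρ ≤ R / 2 := by linarith [le_max_right R₀ (2 * (‖x‖ + 2 * ρ))]
  have hballR : Metric.ball x ρ ⊆ Metric.ball 0 R := by
    refine Metric.ball_subset_ball' ?_
    rw [dist_zero_right]
    linarith [norm_nonneg x]
  obtain ⟨K, hK0, hK⟩ := exists_window_le_ten_mul hEb hEp hconv hlip hρ0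
    (by rwa [hρ, mul_div_cancel₀ _ (by norm_num)]) hER hxR
  obtain ⟨P, hP0, hP⟩ := exists_volume_inter_ball_translate_diff_le hEb hEp x hρ0
  obtain ⟨C, hC⟩ := exists_lintegral_norm_rpow_mul_pairMeasure_le
    (Metric.isOpen_ball.measurableSet.diff hEp.1) sdiff_subset (inter_subset_left.trans hER)
    (disjoint_sdiff_left.mono_right inter_subset_left) hP0 hP hK0 hK
  exact ⟨ρ / 4, by positivity, volume_inter_ball_eq_zero_or hEp.1 hρ0 hballR hC⟩

/-- Theorem 1.1 in dimension 2: if `E ⊆ ℝ²` is a bounded set of finite perimeter such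
that for a.e. `θ ∈ [0,π]` the marginal `w_θ` has convex (interval) support `A_θ` and is
locally Lipschitz in its interior, with `|w_θ'| ≤ C_δ` a.e. on
`{t ∈ A_θ : dist(t, ∂A_θ) ≥ δ}` uniformly in `θ` for each `δ > 0`, then `E` coincides
with a convex set up to Lebesgue measure zero. -/
theorem convex_of_regular_marginals_dim2 (E : Set (EuclideanSpace ℝ (Fin 2)))
    (hEb : Bornology.IsBounded E) (hEp : HasFinitePerimeter E)
    (hconv : ∀ᵐ θ ∂(volume.restrict (Icc (0 : ℝ) π)),
      Convex ℝ (Asupp E θ) ∧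
      ∀ t ∈ interior (Asupp E θ), ∃ ε > (0 : ℝ), ∃ K : NNReal,
        LipschitzOnWith K (margInd E θ) (Metric.ball t ε))
    (hlip : ∀ δ > (0 : ℝ), ∃ C : ℝ,
      ∀ᵐ θ ∂(volume.restrict (Icc (0 : ℝ) π)),
        ∀ᵐ t ∂(volume.restrict {t ∈ Asupp E θ | δ ≤ Metric.infDist t (Asupp E θ)ᶜ}),
          |deriv (margInd E θ) t| ≤ C) :
    ∃ K : Set (EuclideanSpace ℝ (Fin 2)), Convex ℝ K ∧ volume (symmDiff E K) = 0 := by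
  set H := convexHull ℝ (volume.restrict E).support with hH
  have hHc : Convex ℝ H := convex_convexHull ℝ _
  have hnull : ∀ A : Set (EuclideanSpace ℝ (Fin 2)), MeasurableSet A →
      volume (A ∩ ((volume.restrict A).support)ᶜ) = 0 := fun A hA => by
    have h1 := Measure.measure_compl_support (μ := volume.restrict A)
    rwa [Measure.restrict_apply Measure.isClosed_support.isOpen_compl.measurableSet,
      inter_comm] at h1
  have hEH : volume (E \ H) = 0 := by
    refine measure_mono_null (fun y hy => ?_) (hnull E hEp.1)
    exact ⟨hy.1, fun h => hy.2 (subset_convexHull ℝ _ h)⟩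
  have hbd : volume (H \ interior H) = 0 := measure_mono_null
    (sdiff_subset_sdiff_left subset_closure) (hHc.addHaar_frontier volume)
  have hnot : ∀ (A : Set (EuclideanSpace ℝ (Fin 2))) x r, 0 < r → volume (A ∩ Metric.ball x r) = 0 →
      x ∈ ((volume.restrict A).support)ᶜ := fun A x r hr h0 h => by
    have h1 := (Measure.mem_support_iff_forall x).1 h _ (Metric.ball_mem_nhds x hr)
    rw [Measure.restrict_apply Metric.isOpen_ball.measurableSet, inter_comm] at h1
    exact h1.ne' h0
  have hcover : interior H ⊆ ((volume.restrict E).support)ᶜ ∪ ((volume.restrict Eᶜ).support)ᶜ := by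
    intro x hx
    obtain ⟨r, hr, h | h⟩ := exists_ball_volume_eq_zero_or hEb hEp hconv hlip hx
    · exact Or.inl (hnot E x r hr h)
    · exact Or.inr (hnot Eᶜ x r hr (by rwa [inter_comm, ← Set.sdiff_eq]))
  have hdisj : Disjoint ((volume.restrict E).support)ᶜ ((volume.restrict Eᶜ).support)ᶜ := by
    rw [Set.disjoint_left]
    intro x hx hx'
    have ho : IsOpen (((volume.restrict E).support)ᶜ ∩ ((volume.restrict Eᶜ).support)ᶜ) :=
      Measure.isClosed_support.isOpen_compl.inter Measure.isClosed_support.isOpen_compl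
    refine (ho.measure_pos volume ⟨x, hx, hx'⟩).ne' ?_
    refine measure_mono_null (fun y hy => ?_)
      (measure_union_null (hnull E hEp.1) (hnull Eᶜ hEp.1.compl))
    by_cases h : y ∈ E
    · exact Or.inl ⟨h, hy.1⟩
    · exact Or.inr ⟨h, hy.2⟩
  rcases hHc.interior.isPreconnected.subset_or_subset Measure.isClosed_support.isOpen_compl
    Measure.isClosed_support.isOpen_compl hdisj hcover with h | h
  · refine ⟨∅, convex_empty, ?_⟩
    refine measure_mono_null (fun y hy => ?_)
      (measure_union_null hEH (measure_union_null hbd (hnull E hEp.1)))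
    have hyE : y ∈ E := (mem_symmDiff.1 hy).elim (fun h => h.1) fun h => h.1.elim
    by_cases h1 : y ∈ H
    · by_cases h2 : y ∈ interior H
      · exact Or.inr (Or.inr ⟨hyE, h h2⟩)
      · exact Or.inr (Or.inl ⟨h1, h2⟩)
    · exact Or.inl ⟨hyE, h1⟩
  · refine ⟨H, hHc, ?_⟩
    refine measure_mono_null (fun y hy => ?_)
      (measure_union_null hEH (measure_union_null hbd (hnull Eᶜ hEp.1.compl)))
    rcases mem_symmDiff.1 hy with h1 | ⟨h1, hyE⟩
    · exact Or.inl h1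
    · by_cases h2 : y ∈ interior H
      · exact Or.inr (Or.inr ⟨hyE, h h2⟩)
      · exact Or.inr (Or.inl ⟨h1, h2⟩)
end

section
/- Let E ⊆ ℝ² be a bounded set of finite perimeter, φ_ε = 1_E ∗ γ_{2,ε}, and w_{θ,ε} the marginal of φ_ε in direction θ. Then the family of measures ν_ε(dt, dθ) = |log ε|^{−1} |w_{θ,ε}′(t)|² dt dθ on ℝ × [0,π] has uniformly bounded total mass as ε → 0, bounded by a constant times the perimeter of E. -/
open MeasureTheory Set Real Filter

/-- The perimeter `∫_{ℝ²} |∇1_E|`. -/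
noncomputable def perimeter (E : Set (EuclideanSpace ℝ (Fin 2))) : ℝ :=
  sSup (varSet (E.indicator (fun _ => (1 : ℝ))))

/-- Standard Gaussian density on `ℝ²`. -/
noncomputable def gaussian2 (x : EuclideanSpace ℝ (Fin 2)) : ℝ :=
  (2 * π)⁻¹ * exp (-‖x‖ ^ 2 / 2)

/-- Gaussian mollification `φ_ε = 1_E ∗ γ_{2,ε}`. -/
noncomputable def mollifyInd (E : Set (EuclideanSpace ℝ (Fin 2))) (ε : ℝ)
    (x : EuclideanSpace ℝ (Fin 2)) : ℝ :=
  ∫ y, E.indicator (fun _ => (1 : ℝ)) (x - y) * (ε ^ (-2 : ℝ) * gaussian2 (ε⁻¹ • y))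

/-- Marginal of `φ_ε` in direction `θ`: `w_{θ,ε}(t) = ∫ φ_ε(R_θ(t,s)) ds`. -/
noncomputable def margMollify (E : Set (EuclideanSpace ℝ (Fin 2))) (ε θ t : ℝ) : ℝ :=
  ∫ s : ℝ, mollifyInd E ε (rot θ t s)

open scoped Convolution InnerProductSpace

/-- The Euclidean plane. -/
abbrev Plane := EuclideanSpace ℝ (Fin 2)

section ParametricIntegral

variable {G F : Type} [NormedAddCommGroup G] [NormedSpace ℝ G] [FiniteDimensional ℝ G]
  [NormedAddCommGroup F] [NormedSpace ℝ F]

lemma hasFDerivAt_setIntegral_of_contDiff {Φ : G × ℝ → F} (hΦ : ContDiff ℝ 1 Φ)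
    {k : Set ℝ} (hk : IsCompact k) (x₀ : G) :
    HasFDerivAt (fun x => ∫ t in k, Φ (x, t))
      (∫ t in k, (fderiv ℝ Φ (x₀, t)).comp (ContinuousLinearMap.inl ℝ G ℝ)) x₀ := by
  have hcont : Continuous fun p : G × ℝ =>
      (fderiv ℝ Φ p).comp (ContinuousLinearMap.inl ℝ G ℝ) :=
    (hΦ.continuous_fderiv one_ne_zero).clm_comp continuous_const
  obtain ⟨M, hM⟩ := (((isCompact_closedBall x₀ 1).prod hk).image hcont).isBounded.exists_norm_le
  have hfin : IsFiniteMeasure (volume.restrict k) := ⟨by simpa using hk.measure_lt_top⟩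
  refine hasFDerivAt_integral_of_dominated_of_fderiv_le (bound := fun _ => M)
    (F' := fun x t => (fderiv ℝ Φ (x, t)).comp (ContinuousLinearMap.inl ℝ G ℝ))
    (Metric.closedBall_mem_nhds x₀ one_pos) ?_ ?_ ?_ ?_ (integrable_const M) ?_
  · refine Eventually.of_forall fun x => Continuous.aestronglyMeasurable ?_
    exact hΦ.continuous.comp (Continuous.prodMk_right x)
  · exact ((hΦ.continuous.comp (Continuous.prodMk_right x₀)).continuousOn).integrableOn_compact hk
  · exact (hcont.comp (Continuous.prodMk_right x₀)).aestronglyMeasurable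
  · refine (ae_restrict_iff' hk.measurableSet).2 (Eventually.of_forall fun t ht x hx => ?_)
    exact hM _ ⟨(x, t), ⟨hx, ht⟩, rfl⟩
  · refine Eventually.of_forall fun t x _ => ?_
    exact ((hΦ.differentiable one_ne_zero (x, t)).hasFDerivAt).comp x (hasFDerivAt_prodMk_left x t)

lemma contDiff_setIntegral_nat (n : ℕ) : ∀ {F : Type} [NormedAddCommGroup F] [NormedSpace ℝ F]
    {Φ : G × ℝ → F}, ContDiff ℝ (⊤ : ℕ∞) Φ → ∀ {k : Set ℝ}, IsCompact k →
    ContDiff ℝ n (fun x => ∫ t in k, Φ (x, t)) := by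
  induction n with
  | zero =>
    intro F _ _ Φ hΦ k hk
    have h1 : ContDiff ℝ 1 Φ := hΦ.of_le (by exact_mod_cast le_top)
    exact contDiff_zero.2 (Differentiable.continuous (𝕜 := ℝ) fun x =>
      (hasFDerivAt_setIntegral_of_contDiff h1 hk x).differentiableAt)
  | succ n ih =>
    intro F _ _ Φ hΦ k hk
    have h1 : ContDiff ℝ 1 Φ := hΦ.of_le (by exact_mod_cast le_top)
    push_cast
    refine contDiff_succ_iff_fderiv.2 ⟨fun x =>
      (hasFDerivAt_setIntegral_of_contDiff h1 hk x).differentiableAt, by simp, ?_⟩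
    have : fderiv ℝ (fun x => ∫ t in k, Φ (x, t)) = fun x =>
        ∫ t in k, (fderiv ℝ Φ (x, t)).comp (ContinuousLinearMap.inl ℝ G ℝ) :=
      funext fun x => (hasFDerivAt_setIntegral_of_contDiff h1 hk x).fderiv
    rw [this]
    refine ih (Φ := fun p => (fderiv ℝ Φ p).comp (ContinuousLinearMap.inl ℝ G ℝ)) ?_ hk
    exact (hΦ.fderiv_right (by simp)).clm_comp contDiff_const

lemma contDiff_setIntegral {Φ : G × ℝ → F} (hΦ : ContDiff ℝ (⊤ : ℕ∞) Φ)
    {k : Set ℝ} (hk : IsCompact k) :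
    ContDiff ℝ (⊤ : ℕ∞) (fun x => ∫ t in k, Φ (x, t)) :=
  contDiff_infty.2 fun n => contDiff_setIntegral_nat n hΦ hk

end ParametricIntegral

/-- The unit vector at angle `θ`. -/
noncomputable def dirVec (θ : ℝ) : Plane := !₂[cos θ, sin θ]

/-- The odd profile `u ↦ u exp(-b u² / 2)`. -/
noncomputable def oddProfile (b u : ℝ) : ℝ := u * exp (-b * u ^ 2 / 2)

/-- The derivative of `oddProfile`. -/
noncomputable def evenProfile (b u : ℝ) : ℝ := (1 - b * u ^ 2) * exp (-b * u ^ 2 / 2)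

/-- The angular average of the plane waves with profile `oddProfile`. -/
noncomputable def waveField (b : ℝ) (z : Plane) : Plane :=
  ∫ θ in Icc (0 : ℝ) π, oddProfile b ⟪z, dirVec θ⟫_ℝ • dirVec θ

lemma inner_dirVec (z : Plane) (θ : ℝ) : ⟪z, dirVec θ⟫_ℝ = z 0 * cos θ + z 1 * sin θ := by
  simp [dirVec, PiLp.inner_apply, Fin.sum_univ_two, mul_comm]

@[fun_prop]
lemma contDiff_dirVec {n : WithTop ℕ∞} : ContDiff ℝ n dirVec := by
  rw [contDiff_euclidean]
  intro i
  fin_cases i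
  · simpa [dirVec] using contDiff_cos
  · simpa [dirVec] using contDiff_sin

lemma hasDerivAt_oddProfile (b u : ℝ) : HasDerivAt (oddProfile b) (evenProfile b u) u := by
  have h := (hasDerivAt_id u).mul (((((hasDerivAt_id u).pow 2).const_mul (-b)).div_const 2).exp)
  refine h.congr_deriv ?_
  simp [evenProfile]
  ring

lemma contDiff_waveField_integrand (b : ℝ) {n : WithTop ℕ∞} :
    ContDiff ℝ n fun p : Plane × ℝ => oddProfile b ⟪p.1, dirVec p.2⟫_ℝ • dirVec p.2 := by
  unfold oddProfile
  have h1 : ContDiff ℝ n fun p : Plane × ℝ => dirVec p.2 := contDiff_dirVec.comp contDiff_snd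
  have h2 : ContDiff ℝ n fun p : Plane × ℝ => ⟪p.1, dirVec p.2⟫_ℝ := contDiff_fst.inner ℝ h1
  exact (h2.mul (((contDiff_const.mul (h2.pow 2)).div_const 2).exp)).smul h1

lemma contDiff_waveField (b : ℝ) : ContDiff ℝ (⊤ : ℕ∞) (waveField b) :=
  contDiff_setIntegral (contDiff_waveField_integrand b) isCompact_Icc

lemma continuous_dirVec : Continuous dirVec := (contDiff_dirVec (n := 0)).continuous

lemma continuous_evenProfile (b : ℝ) : Continuous (evenProfile b) := by
  unfold evenProfile; fun_prop

lemma continuous_oddProfile (b : ℝ) : Continuous (oddProfile b) := by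
  unfold oddProfile; fun_prop

lemma diverg_waveField (b : ℝ) (z : Plane) :
    diverg (waveField b) z = ∫ θ in Icc (0 : ℝ) π, evenProfile b ⟪z, dirVec θ⟫_ℝ := by
  set Φ : Plane × ℝ → Plane := fun p => oddProfile b ⟪p.1, dirVec p.2⟫_ℝ • dirVec p.2 with hΦ
  have hsm : ContDiff ℝ 1 Φ := contDiff_waveField_integrand b
  have hd := (hasFDerivAt_setIntegral_of_contDiff hsm (isCompact_Icc (a := (0 : ℝ)) (b := π))
    z).fderiv
  have hcont : Continuous fun t : ℝ =>
      (fderiv ℝ Φ (z, t)).comp (ContinuousLinearMap.inl ℝ Plane ℝ) :=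
    ((hsm.continuous_fderiv one_ne_zero).comp (Continuous.prodMk_right z)).clm_comp
      continuous_const
  have hint := hcont.continuousOn.integrableOn_compact (μ := volume)
    (isCompact_Icc (a := (0 : ℝ)) (b := π))
  have hpt : ∀ t v, ((fderiv ℝ Φ (z, t)).comp (ContinuousLinearMap.inl ℝ Plane ℝ)) v =
      (evenProfile b ⟪z, dirVec t⟫_ℝ * ⟪v, dirVec t⟫_ℝ) • dirVec t := by
    intro t v
    have h1 : HasFDerivAt (fun x => Φ (x, t))
        ((fderiv ℝ Φ (z, t)).comp (ContinuousLinearMap.inl ℝ Plane ℝ)) z :=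
      HasFDerivAt.comp (g := Φ) z (hsm.differentiable one_ne_zero (z, t)).hasFDerivAt
        (hasFDerivAt_prodMk_left z t)
    have h2 : HasFDerivAt (fun x : Plane => ⟪x, dirVec t⟫_ℝ)
        ((innerSL ℝ).flip (dirVec t)) z :=
      ((innerSL ℝ).flip (dirVec t)).hasFDerivAt
    have h3 := (((hasDerivAt_oddProfile b _).comp_hasFDerivAt z h2)).smul_const (dirVec t)
    rw [h1.unique h3]
    rfl
  have hcoord : ∀ i : Fin 2, fderiv ℝ (waveField b) z (EuclideanSpace.single i 1) i =
      ∫ θ in Icc (0 : ℝ) π, evenProfile b ⟪z, dirVec θ⟫_ℝ * dirVec θ i * dirVec θ i := by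
    intro i
    change fderiv ℝ (fun x => ∫ t in Icc (0 : ℝ) π, Φ (x, t)) z _ i = _
    rw [hd, ContinuousLinearMap.integral_apply hint]
    have := (EuclideanSpace.proj (𝕜 := ℝ) i : Plane →L[ℝ] ℝ).integral_comp_comm
      (hint.apply_continuousLinearMap (EuclideanSpace.single i (1 : ℝ)))
    refine this.symm.trans ?_
    congr 1 with t
    rw [hpt]
    simp [EuclideanSpace.inner_single_left]
  have hi : ∀ i : Fin 2, IntegrableOn
      (fun θ => evenProfile b ⟪z, dirVec θ⟫_ℝ * dirVec θ i * dirVec θ i) (Icc 0 π) := by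
    intro i
    have h1 := continuous_dirVec
    have h2 : Continuous fun θ => dirVec θ i := by fun_prop
    exact ((((continuous_evenProfile b).comp (continuous_const.inner h1)).mul h2).mul
      h2).continuousOn.integrableOn_compact isCompact_Icc
  rw [diverg, Fin.sum_univ_two, hcoord, hcoord, ← integral_add (hi 0) (hi 1)]
  congr 1 with θ
  simp only [dirVec, PiLp.toLp_apply, Matrix.cons_val_zero, Matrix.cons_val_one]
  linear_combination (evenProfile b _) * (sin_sq_add_cos_sq θ)

lemma exists_angle (z : Plane) : ∃ α : ℝ, z 0 = ‖z‖ * cos α ∧ z 1 = ‖z‖ * sin α := by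
  have hn : ‖z‖ = ‖(⟨z 0, z 1⟩ : ℂ)‖ := by
    rw [EuclideanSpace.norm_eq, Complex.norm_eq_sqrt_sq_add_sq]
    simp [Fin.sum_univ_two]
  refine ⟨Complex.arg ⟨z 0, z 1⟩, ?_, ?_⟩
  · rw [hn, Complex.norm_mul_cos_arg]
  · rw [hn, Complex.norm_mul_sin_arg]

lemma norm_mul_norm_eq_abs_inner {z v : Plane} (h : z 0 * v 1 = z 1 * v 0) :
    ‖z‖ * ‖v‖ = |⟪z, v⟫_ℝ| := by
  rw [← abs_of_nonneg (by positivity : 0 ≤ ‖z‖ * ‖v‖), ← sq_eq_sq_iff_abs_eq_abs, mul_pow,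
    EuclideanSpace.real_norm_sq_eq, EuclideanSpace.real_norm_sq_eq]
  simp only [PiLp.inner_apply, Fin.sum_univ_two, RCLike.inner_apply, conj_trivial]
  linear_combination (z 0 * v 1 - z 1 * v 0) * h

lemma integral_inv_one_add_mul_sq_le {l : ℝ} (hl : 0 ≤ l) :
    ∫ x in (0 : ℝ)..π, (1 + (l * (x - π / 2)) ^ 2)⁻¹ ≤ 2 * π / (1 + l) := by
  have hc : Continuous fun x : ℝ => (1 + (l * (x - π / 2)) ^ 2)⁻¹ :=
    Continuous.inv₀ (by fun_prop) fun x => by positivity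
  rcases le_total l 1 with h1 | h1
  · calc ∫ x in (0 : ℝ)..π, (1 + (l * (x - π / 2)) ^ 2)⁻¹ ≤ ∫ x in (0 : ℝ)..π, (1 : ℝ) := by
          refine intervalIntegral.integral_mono pi_pos.le (hc.intervalIntegrable _ _)
            (by simp) fun x => inv_le_one_of_one_le₀ (by nlinarith [sq_nonneg (l * (x - π / 2))])
      _ = π := by simp
      _ ≤ 2 * π / (1 + l) := by
          rw [le_div_iff₀ (by positivity)]
          nlinarith [pi_pos]
  · have hl0 : 0 < l := by linarith
    have hint : Integrable fun x : ℝ => (1 + (l * (x - π / 2)) ^ 2)⁻¹ :=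
      (integrable_inv_one_add_sq.comp_mul_left' hl0.ne').comp_sub_right (π / 2)
    calc ∫ x in (0 : ℝ)..π, (1 + (l * (x - π / 2)) ^ 2)⁻¹
        ≤ ∫ x : ℝ, (1 + (l * (x - π / 2)) ^ 2)⁻¹ := by
          rw [intervalIntegral.integral_of_le pi_pos.le]
          exact setIntegral_le_integral hint (Eventually.of_forall fun x => by positivity)
      _ = π / l := by
          rw [integral_sub_right_eq_self (fun x : ℝ => (1 + (l * x) ^ 2)⁻¹) (π / 2),
            Measure.integral_comp_mul_left (fun x : ℝ => (1 + x ^ 2)⁻¹) l,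
            integral_univ_inv_one_add_sq, abs_of_pos (by positivity), smul_eq_mul]
          ring
      _ ≤ 2 * π / (1 + l) := by
          rw [div_le_div_iff₀ hl0 (by positivity)]
          nlinarith [pi_pos]

lemma sq_mul_exp_le {b : ℝ} (hb : 0 < b) (u : ℝ) :
    u ^ 2 * exp (-b * u ^ 2 / 2) ≤ 4 / b * (1 + b * u ^ 2 / 2)⁻¹ := by
  have hx : 0 ≤ b * u ^ 2 / 2 := by positivity
  have h := quadratic_le_exp_of_nonneg hx
  rw [show -b * u ^ 2 / 2 = -(b * u ^ 2 / 2) by ring, exp_neg, ← div_eq_mul_inv, ← div_eq_mul_inv,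
    div_div, div_le_div_iff₀ (exp_pos _) (by positivity)]
  have : u ^ 2 * (b * (1 + b * u ^ 2 / 2)) =
    2 * (b * u ^ 2 / 2) * (1 + b * u ^ 2 / 2) := by ring
  rw [this]
  nlinarith

lemma two_div_pi_mul_abs_le_abs_cos {x : ℝ} (h0 : 0 ≤ x) (h1 : x ≤ π) :
    2 / π * |x - π / 2| ≤ |cos x| := by
  rcases le_total x (π / 2) with h | h
  · rw [abs_sub_comm, abs_of_nonneg (sub_nonneg.2 h), ← sin_pi_div_two_sub]
    exact (mul_le_sin (by linarith) (by linarith)).trans (le_abs_self _)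
  · rw [abs_of_nonneg (sub_nonneg.2 h), ← abs_neg, ← sin_sub_pi_div_two]
    exact (mul_le_sin (by linarith) (by linarith)).trans (le_abs_self _)

lemma setIntegral_sq_mul_exp_le {b : ℝ} (hb : 0 < b) (z : Plane) :
    ∫ θ in Icc (0 : ℝ) π, ⟪z, dirVec θ⟫_ℝ ^ 2 * exp (-b * ⟪z, dirVec θ⟫_ℝ ^ 2 / 2) ≤
      4 / b * (2 * π / (1 + √(2 * b) * ‖z‖ / π)) := by
  obtain ⟨α, h0, h1⟩ := exists_angle z
  have hz : ∀ θ, ⟪z, dirVec θ⟫_ℝ = ‖z‖ * cos (θ - α) := by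
    intro θ
    rw [inner_dirVec, cos_sub]
    linear_combination cos θ * h0 + sin θ * h1
  set q : ℝ → ℝ := fun θ => (‖z‖ * cos θ) ^ 2 * exp (-b * (‖z‖ * cos θ) ^ 2 / 2) with hq
  have hper : Function.Periodic q π := fun θ => by simp [hq, cos_add_pi]
  have hl : 0 ≤ √(2 * b) * ‖z‖ / π := by positivity
  have e1 : ∫ θ in Icc (0 : ℝ) π, ⟪z, dirVec θ⟫_ℝ ^ 2 * exp (-b * ⟪z, dirVec θ⟫_ℝ ^ 2 / 2) =
      ∫ θ in (0 : ℝ)..π, q θ := by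
    rw [integral_Icc_eq_integral_Ioc, ← intervalIntegral.integral_of_le pi_pos.le]
    simp_rw [hz]
    rw [intervalIntegral.integral_comp_sub_right q α]
    have := hper.intervalIntegral_add_eq (0 - α) 0
    rw [zero_add] at this
    rw [← this]
    congr 1
    ring
  rw [e1]
  calc ∫ θ in (0 : ℝ)..π, q θ
      ≤ ∫ θ in (0 : ℝ)..π, 4 / b * (1 + (√(2 * b) * ‖z‖ / π * (θ - π / 2)) ^ 2)⁻¹ := by
        refine intervalIntegral.integral_mono_on pi_pos.le (Continuous.intervalIntegrable
          (by fun_prop) _ _) (Continuous.intervalIntegrable ?_ _ _) fun θ hθ => ?_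
        · exact continuous_const.mul (Continuous.inv₀ (by fun_prop) fun x => by positivity)
        · refine (sq_mul_exp_le hb _).trans ?_
          gcongr
          have h2 := two_div_pi_mul_abs_le_abs_cos hθ.1 hθ.2
          have h3 : (2 / π * |θ - π / 2|) ^ 2 ≤ |cos θ| ^ 2 := by gcongr
          rw [mul_pow, sq_abs, sq_abs] at h3
          rw [mul_pow, div_pow, mul_pow, sq_sqrt (by positivity)]
          calc 2 * b * ‖z‖ ^ 2 / π ^ 2 * (θ - π / 2) ^ 2
              = b * ‖z‖ ^ 2 / 2 * ((2 / π) ^ 2 * (θ - π / 2) ^ 2) := by ring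
            _ ≤ b * ‖z‖ ^ 2 / 2 * cos θ ^ 2 := by gcongr
            _ = b * (‖z‖ * cos θ) ^ 2 / 2 := by ring
    _ ≤ _ := by
        rw [intervalIntegral.integral_const_mul]
        gcongr
        exact integral_inv_one_add_mul_sq_le hl

lemma inner_waveField (b : ℝ) (z v : Plane) :
    ⟪v, waveField b z⟫_ℝ =
      ∫ θ in Icc (0 : ℝ) π, oddProfile b ⟪z, dirVec θ⟫_ℝ * ⟪v, dirVec θ⟫_ℝ := by
  have hc : Continuous fun θ => oddProfile b ⟪z, dirVec θ⟫_ℝ • dirVec θ :=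
    ((continuous_oddProfile b).comp (continuous_const.inner continuous_dirVec)).smul
      continuous_dirVec
  rw [waveField, ← integral_inner (hc.continuousOn.integrableOn_compact isCompact_Icc)]
  simp_rw [inner_smul_right]

lemma waveField_radial {b : ℝ} (hb : b ≠ 0) (z : Plane) :
    z 0 * waveField b z 1 = z 1 * waveField b z 0 := by
  have h := inner_waveField b z !₂[-z 1, z 0]
  have hd : ∀ θ : ℝ, HasDerivAt
      (fun θ => b⁻¹ * exp (-b * (z 0 * cos θ + z 1 * sin θ) ^ 2 / 2))
      (oddProfile b ⟪z, dirVec θ⟫_ℝ * ⟪(!₂[-z 1, z 0] : Plane), dirVec θ⟫_ℝ) θ := by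
    intro θ
    have hu : HasDerivAt (fun θ => z 0 * cos θ + z 1 * sin θ) (z 0 * (-sin θ) + z 1 * cos θ) θ :=
      ((hasDerivAt_cos θ).const_mul _).add ((hasDerivAt_sin θ).const_mul _)
    have h2 := (((((hu.pow 2).const_mul (-b)).div_const 2).exp).const_mul b⁻¹)
    refine h2.congr_deriv ?_
    rw [inner_dirVec, inner_dirVec]
    simp [oddProfile]
    field_simp
    ring
  have hcont : Continuous fun θ =>
      oddProfile b ⟪z, dirVec θ⟫_ℝ * ⟪(!₂[-z 1, z 0] : Plane), dirVec θ⟫_ℝ :=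
    ((continuous_oddProfile b).comp (continuous_const.inner continuous_dirVec)).mul
      (continuous_const.inner continuous_dirVec)
  rw [integral_Icc_eq_integral_Ioc, ← intervalIntegral.integral_of_le pi_pos.le,
    intervalIntegral.integral_eq_sub_of_hasDerivAt (fun θ _ => hd θ)
      (hcont.intervalIntegrable _ _)] at h
  simp [PiLp.inner_apply, Fin.sum_univ_two] at h
  linarith

lemma norm_mul_norm_waveField_le {b : ℝ} (hb : 0 < b) (z : Plane) :
    ‖z‖ * ‖waveField b z‖ ≤ 4 / b * (2 * π / (1 + √(2 * b) * ‖z‖ / π)) := by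
  rw [norm_mul_norm_eq_abs_inner (waveField_radial hb.ne' z), inner_waveField]
  have e : ∀ θ, oddProfile b ⟪z, dirVec θ⟫_ℝ * ⟪z, dirVec θ⟫_ℝ =
      ⟪z, dirVec θ⟫_ℝ ^ 2 * exp (-b * ⟪z, dirVec θ⟫_ℝ ^ 2 / 2) := fun θ => by
    rw [oddProfile]; ring
  simp_rw [e]
  rw [abs_of_nonneg (integral_nonneg fun θ => by positivity)]
  exact setIntegral_sq_mul_exp_le hb z

lemma norm_waveField_le {ε : ℝ} (hε : 0 < ε) {z : Plane} (hz : z ≠ 0) :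
    ‖waveField (1 / (2 * ε ^ 2)) z‖ ≤ 16 * π ^ 2 * ε ^ 3 * (‖z‖ * (ε + ‖z‖))⁻¹ := by
  have hz' : 0 < ‖z‖ := norm_pos_iff.2 hz
  have h := norm_mul_norm_waveField_le (b := 1 / (2 * ε ^ 2)) (by positivity) z
  have hs : √(2 * (1 / (2 * ε ^ 2))) = ε⁻¹ := by
    rw [show 2 * (1 / (2 * ε ^ 2)) = (ε⁻¹) ^ 2 by field_simp, sqrt_sq (by positivity)]
  rw [hs] at h
  have h2 : 4 / (1 / (2 * ε ^ 2)) * (2 * π / (1 + ε⁻¹ * ‖z‖ / π)) =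
      16 * π ^ 2 * ε ^ 3 / (ε * π + ‖z‖) := by
    field_simp
    ring
  rw [h2] at h
  have h3 : 16 * π ^ 2 * ε ^ 3 / (ε * π + ‖z‖) ≤ 16 * π ^ 2 * ε ^ 3 / (ε + ‖z‖) := by
    gcongr
    nlinarith [pi_gt_three]
  rw [mul_inv, ← mul_assoc, mul_right_comm, ← div_eq_mul_inv, ← div_eq_mul_inv, le_div_iff₀ hz',
    mul_comm]
  exact h.trans h3

lemma integrable_sq_mul_exp_neg_mul_sq {d : ℝ} (hd : 0 < d) :
    Integrable fun x : ℝ => x ^ 2 * exp (-d * x ^ 2) := by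
  simpa [rpow_two] using integrable_rpow_mul_exp_neg_mul_sq hd (s := 2) (by norm_num)

lemma integral_sq_mul_exp_neg_mul_sq {d : ℝ} (hd : 0 < d) :
    ∫ x : ℝ, x ^ 2 * exp (-d * x ^ 2) = √(π / d) / (2 * d) := by
  have hderiv : ∀ x : ℝ, HasDerivAt (fun x => x * exp (-d * x ^ 2))
      (exp (-d * x ^ 2) - 2 * d * (x ^ 2 * exp (-d * x ^ 2))) x := by
    intro x
    have h := (hasDerivAt_id x).mul ((((hasDerivAt_id x).pow 2).const_mul (-d)).exp)
    refine h.congr_deriv ?_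
    simp
    ring
  have h0 := integrable_exp_neg_mul_sq hd
  have h2 := (integrable_sq_mul_exp_neg_mul_sq hd).const_mul (2 * d)
  have h := integral_eq_zero_of_hasDerivAt_of_integrable hderiv (h0.sub h2)
    (integrable_mul_exp_neg_mul_sq hd)
  rw [integral_sub h0 h2, integral_const_mul, integral_gaussian] at h
  rw [eq_div_iff (by positivity)]
  linarith

lemma oddProfile_mul_oddProfile (b t a a' : ℝ) :
    oddProfile (2 * b) (t - a) * oddProfile (2 * b) (t - a') =
      exp (-b * (a - a') ^ 2 / 2) *
        ((t - (a + a') / 2) ^ 2 * exp (-(2 * b) * (t - (a + a') / 2) ^ 2) -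
          (a - a') ^ 2 / 4 * exp (-(2 * b) * (t - (a + a') / 2) ^ 2)) := by
  have h : exp (-(2 * b) * (t - a) ^ 2 / 2) * exp (-(2 * b) * (t - a') ^ 2 / 2) =
      exp (-b * (a - a') ^ 2 / 2) * exp (-(2 * b) * (t - (a + a') / 2) ^ 2) := by
    rw [← exp_add, ← exp_add]
    congr 1
    ring
  rw [oddProfile, oddProfile]
  linear_combination (t - a) * (t - a') * h

lemma integrable_oddProfile_mul_oddProfile {b : ℝ} (hb : 0 < b) (a a' : ℝ) :
    Integrable fun t => oddProfile (2 * b) (t - a) * oddProfile (2 * b) (t - a') := by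
  simp_rw [oddProfile_mul_oddProfile]
  have h2b : 0 < 2 * b := by positivity
  exact (((integrable_sq_mul_exp_neg_mul_sq h2b).comp_sub_right _).sub
    (((integrable_exp_neg_mul_sq h2b).comp_sub_right _).const_mul _)).const_mul _

lemma integral_oddProfile_mul_oddProfile {b : ℝ} (hb : 0 < b) (a a' : ℝ) :
    ∫ t, oddProfile (2 * b) (t - a) * oddProfile (2 * b) (t - a') =
      √(π / (2 * b)) / (4 * b) * evenProfile b (a - a') := by
  simp_rw [oddProfile_mul_oddProfile]
  have h2b : 0 < 2 * b := by positivity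
  rw [integral_const_mul, integral_sub
    ((integrable_sq_mul_exp_neg_mul_sq h2b).comp_sub_right _)
    (((integrable_exp_neg_mul_sq h2b).comp_sub_right _).const_mul _), integral_const_mul,
    integral_sub_right_eq_self (fun t : ℝ => t ^ 2 * exp (-(2 * b) * t ^ 2)),
    integral_sub_right_eq_self (fun t : ℝ => exp (-(2 * b) * t ^ 2)),
    integral_sq_mul_exp_neg_mul_sq h2b, integral_gaussian, evenProfile]
  field_simp
  ring

lemma sq_mul_exp_le_const {b : ℝ} (hb : 0 < b) (u : ℝ) :
    u ^ 2 * exp (-b * u ^ 2 / 2) ≤ 4 / b := by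
  refine (sq_mul_exp_le hb u).trans (mul_le_of_le_one_right (by positivity) ?_)
  exact inv_le_one_of_one_le₀ (by have : 0 ≤ b * u ^ 2 / 2 := by positivity
                                  linarith)

lemma abs_oddProfile_le {b : ℝ} (hb : 0 < b) (u : ℝ) : |oddProfile b u| ≤ 1 + 2 / b := by
  have h := sq_mul_exp_le_const (b := 2 * b) (by positivity) u
  have h2 : |oddProfile b u| ^ 2 ≤ 2 / b := by
    calc |oddProfile b u| ^ 2 = u ^ 2 * exp (-(2 * b) * u ^ 2 / 2) := by
          rw [sq_abs, oddProfile, mul_pow, ← exp_nat_mul]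
          congr 2
          push_cast
          ring
      _ ≤ 4 / (2 * b) := h
      _ = 2 / b := by field_simp; norm_num
  nlinarith [sq_nonneg (|oddProfile b u| - 1), abs_nonneg (oddProfile b u)]

lemma abs_evenProfile_le {b : ℝ} (hb : 0 < b) (u : ℝ) : |evenProfile b u| ≤ 4 := by
  have h := sq_mul_exp_le_const hb u
  have h1 : exp (-b * u ^ 2 / 2) ≤ 1 := exp_le_one_iff.2 (by nlinarith [sq_nonneg u])
  have h2 : b * (u ^ 2 * exp (-b * u ^ 2 / 2)) ≤ 4 := by
    calc _ ≤ b * (4 / b) := by gcongr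
      _ = 4 := by field_simp
  have h3 := exp_pos (-b * u ^ 2 / 2)
  have h4 : 0 ≤ b * (u ^ 2 * exp (-b * u ^ 2 / 2)) := by positivity
  rw [evenProfile, abs_le]
  constructor <;> nlinarith

section Superposition

variable {α : Type*} [MeasurableSpace α] {μ : Measure α} [IsFiniteMeasure μ] {a : α → ℝ} {b : ℝ}

lemma integrable_oddProfile_mul_prod (hb : 0 < b) (ha : Measurable a) :
    Integrable (fun q : ℝ × α × α =>
      oddProfile (2 * b) (q.1 - a q.2.1) * oddProfile (2 * b) (q.1 - a q.2.2))
      (volume.prod (μ.prod μ)) := by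
  have hm : Measurable (oddProfile (2 * b)) := (continuous_oddProfile _).measurable
  have hF : Measurable (fun q : ℝ × α × α =>
      oddProfile (2 * b) (q.1 - a q.2.1) * oddProfile (2 * b) (q.1 - a q.2.2)) := by fun_prop
  rw [integrable_prod_iff' hF.aestronglyMeasurable]
  refine ⟨Eventually.of_forall fun p =>
    integrable_oddProfile_mul_oddProfile hb (a p.1) (a p.2), ?_⟩
  refine Integrable.of_bound (C := √(π / (2 * b)) / (4 * b)) ?_ (Eventually.of_forall fun p => ?_)
  · exact (hF.norm.stronglyMeasurable.integral_prod_left' (μ := volume)).aestronglyMeasurable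
  · rw [norm_of_nonneg (integral_nonneg fun t => norm_nonneg _)]
    have hsq : ∀ c, Integrable fun t => oddProfile (2 * b) (t - c) * oddProfile (2 * b) (t - c) :=
      fun c => integrable_oddProfile_mul_oddProfile hb _ _
    have hval : ∀ c, ∫ t, oddProfile (2 * b) (t - c) * oddProfile (2 * b) (t - c) =
        √(π / (2 * b)) / (4 * b) := fun c => by
      rw [integral_oddProfile_mul_oddProfile hb]; simp [evenProfile]
    calc ∫ t, ‖oddProfile (2 * b) (t - a p.1) * oddProfile (2 * b) (t - a p.2)‖
        ≤ ∫ t, (1 / 2 * (oddProfile (2 * b) (t - a p.1) * oddProfile (2 * b) (t - a p.1)) +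
            1 / 2 * (oddProfile (2 * b) (t - a p.2) * oddProfile (2 * b) (t - a p.2))) := by
          refine integral_mono (integrable_oddProfile_mul_oddProfile hb _ _).norm
            (((hsq _).const_mul _).add ((hsq _).const_mul _)) fun t => ?_
          rw [norm_eq_abs, abs_le]
          constructor
          · nlinarith [sq_nonneg (oddProfile (2 * b) (t - a p.1) +
              oddProfile (2 * b) (t - a p.2))]
          · nlinarith [sq_nonneg (oddProfile (2 * b) (t - a p.1) -
              oddProfile (2 * b) (t - a p.2))]
      _ = √(π / (2 * b)) / (4 * b) := by
          rw [integral_add ((hsq _).const_mul _) ((hsq _).const_mul _), integral_const_mul,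
            integral_const_mul, hval, hval]
          ring

lemma sq_integral_oddProfile (t : ℝ) :
    (∫ y, oddProfile (2 * b) (t - a y) ∂μ) ^ 2 =
      ∫ p, oddProfile (2 * b) (t - a p.1) * oddProfile (2 * b) (t - a p.2) ∂(μ.prod μ) := by
  rw [sq, ← integral_prod_mul]

lemma integrable_sq_integral_oddProfile (hb : 0 < b) (ha : Measurable a) :
    Integrable fun t => (∫ y, oddProfile (2 * b) (t - a y) ∂μ) ^ 2 := by
  simp_rw [sq_integral_oddProfile]
  exact (integrable_oddProfile_mul_prod hb ha).integral_prod_left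

lemma integral_sq_integral_oddProfile (hb : 0 < b) (ha : Measurable a) :
    ∫ t, (∫ y, oddProfile (2 * b) (t - a y) ∂μ) ^ 2 =
      √(π / (2 * b)) / (4 * b) * ∫ p, evenProfile b (a p.1 - a p.2) ∂(μ.prod μ) := by
  simp_rw [sq_integral_oddProfile]
  rw [integral_integral_swap (integrable_oddProfile_mul_prod hb ha), ← integral_const_mul]
  simp_rw [integral_oddProfile_mul_oddProfile hb]

end Superposition

section Marginal

variable {E : Set Plane} {ε : ℝ}

lemma gaussian2_scaled (hε : 0 < ε) (x : Plane) :
    ε ^ (-2 : ℝ) * gaussian2 (ε⁻¹ • x) =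
      1 / (2 * ε ^ 2) / π * exp (-(1 / (2 * ε ^ 2)) * ‖x‖ ^ 2) := by
  rw [gaussian2, norm_smul, norm_inv, norm_of_nonneg hε.le, rpow_neg hε.le, rpow_two]
  have : -(ε⁻¹ * ‖x‖) ^ 2 / 2 = -(1 / (2 * ε ^ 2)) * ‖x‖ ^ 2 := by
    field_simp
  rw [this]
  field_simp

lemma mollifyInd_eq (hE : MeasurableSet E) (hε : 0 < ε) (x : Plane) :
    mollifyInd E ε x =
      ∫ y in E, 1 / (2 * ε ^ 2) / π * exp (-(1 / (2 * ε ^ 2)) * ‖x - y‖ ^ 2) := by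
  rw [mollifyInd, ← integral_indicator hE, ← integral_sub_left_eq_self _ volume x]
  congr 1 with y
  rw [sub_sub_cancel, gaussian2_scaled hε]
  by_cases hy : y ∈ E <;> simp [hy]

lemma norm_rot_sub_sq (θ t s : ℝ) (y : Plane) :
    ‖rot θ t s - y‖ ^ 2 =
      (t - ⟪y, dirVec θ⟫_ℝ) ^ 2 + (s - (y 1 * cos θ - y 0 * sin θ)) ^ 2 := by
  rw [EuclideanSpace.real_norm_sq_eq, inner_dirVec]
  simp only [rot, WithLp.equiv_symm_apply, Fin.sum_univ_two, PiLp.sub_apply,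
    Matrix.cons_val_zero, Matrix.cons_val_one]
  linear_combination (t ^ 2 + s ^ 2 - y 0 ^ 2 - y 1 ^ 2) * sin_sq_add_cos_sq θ

lemma margMollify_eq (hE : MeasurableSet E) (hE' : volume E ≠ ⊤) (hε : 0 < ε) (θ t : ℝ) :
    margMollify E ε θ t =
      1 / (2 * ε ^ 2) / π * √(π / (1 / (2 * ε ^ 2))) *
        ∫ y in E, exp (-(1 / (2 * ε ^ 2)) * (t - ⟪y, dirVec θ⟫_ℝ) ^ 2) := by
  have : IsFiniteMeasure (volume.restrict E) := ⟨by simpa using hE'.lt_top⟩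
  set b := 1 / (2 * ε ^ 2) with hb
  have hb0 : 0 < b := by positivity
  have hsplit : ∀ (s : ℝ) (y : Plane), b / π * exp (-b * ‖rot θ t s - y‖ ^ 2) =
      b / π * exp (-b * (t - ⟪y, dirVec θ⟫_ℝ) ^ 2) *
        exp (-b * (s - (y 1 * cos θ - y 0 * sin θ)) ^ 2) := by
    intro s y
    rw [norm_rot_sub_sq, mul_add, exp_add, mul_assoc]
  have hgauss : ∀ (A : ℝ) (y : Plane),
      ∫ s, A * exp (-b * (s - (y 1 * cos θ - y 0 * sin θ)) ^ 2) = A * √(π / b) := by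
    intro A y
    rw [integral_const_mul, integral_sub_right_eq_self (fun s : ℝ => exp (-b * s ^ 2)),
      integral_gaussian]
  have hF : Continuous fun q : ℝ × Plane =>
      b / π * exp (-b * (t - ⟪q.2, dirVec θ⟫_ℝ) ^ 2) *
        exp (-b * (q.1 - (q.2 1 * cos θ - q.2 0 * sin θ)) ^ 2) := by fun_prop
  have hint : Integrable (fun q : ℝ × Plane =>
      b / π * exp (-b * (t - ⟪q.2, dirVec θ⟫_ℝ) ^ 2) *
        exp (-b * (q.1 - (q.2 1 * cos θ - q.2 0 * sin θ)) ^ 2))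
      (volume.prod (volume.restrict E)) := by
    rw [integrable_prod_iff' hF.aestronglyMeasurable]
    refine ⟨Eventually.of_forall fun y => ?_, ?_⟩
    · exact ((integrable_exp_neg_mul_sq hb0).comp_sub_right
        (y 1 * cos θ - y 0 * sin θ)).const_mul
          (b / π * exp (-b * (t - ⟪y, dirVec θ⟫_ℝ) ^ 2))
    · have hn : ∀ (y : Plane) (s : ℝ), ‖b / π * exp (-b * (t - ⟪y, dirVec θ⟫_ℝ) ^ 2) *
          exp (-b * (s - (y 1 * cos θ - y 0 * sin θ)) ^ 2)‖ =
          b / π * exp (-b * (t - ⟪y, dirVec θ⟫_ℝ) ^ 2) *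
          exp (-b * (s - (y 1 * cos θ - y 0 * sin θ)) ^ 2) := fun y s =>
        norm_of_nonneg (by positivity)
      simp_rw [hn, hgauss]
      refine Integrable.of_bound (C := b / π * 1 * √(π / b))
        (Continuous.aestronglyMeasurable (by fun_prop)) (Eventually.of_forall fun y => ?_)
      rw [norm_of_nonneg (by positivity)]
      gcongr
      exact exp_le_one_iff.2 (by nlinarith [sq_nonneg (t - ⟪y, dirVec θ⟫_ℝ)])
  simp_rw [margMollify, mollifyInd_eq hE hε, ← hb, hsplit]
  rw [integral_integral_swap hint]
  simp_rw [hgauss]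
  rw [← integral_const_mul]
  congr 1 with y
  ring

lemma deriv_margMollify (hE : MeasurableSet E) (hE' : volume E ≠ ⊤) (hε : 0 < ε) (θ t : ℝ) :
    deriv (margMollify E ε θ) t =
      1 / (2 * ε ^ 2) / π * √(π / (1 / (2 * ε ^ 2))) * (-(2 * (1 / (2 * ε ^ 2)))) *
        ∫ y in E, oddProfile (2 * (1 / (2 * ε ^ 2))) (t - ⟪y, dirVec θ⟫_ℝ) := by
  have : IsFiniteMeasure (volume.restrict E) := ⟨by simpa using hE'.lt_top⟩
  rw [funext (margMollify_eq hE hE' hε θ)]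
  set b := 1 / (2 * ε ^ 2) with hb
  have hb0 : 0 < b := by positivity
  have h := (hasDerivAt_integral_of_dominated_loc_of_deriv_le (μ := volume.restrict E)
    (F := fun t y => exp (-b * (t - ⟪y, dirVec θ⟫_ℝ) ^ 2))
    (F' := fun t y => -(2 * b) * oddProfile (2 * b) (t - ⟪y, dirVec θ⟫_ℝ))
    (bound := fun _ => 2 * b * (1 + 2 / (2 * b))) (x₀ := t) univ_mem
    (Eventually.of_forall fun t => Continuous.aestronglyMeasurable (by fun_prop))
    ?_ ?_ ?_ (integrable_const _) ?_).2
  · rw [(h.const_mul _).deriv, integral_const_mul, mul_assoc (b / π * √(π / b))]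
  · refine Integrable.of_bound (C := 1) (Continuous.aestronglyMeasurable (by fun_prop))
      (Eventually.of_forall fun y => ?_)
    rw [norm_of_nonneg (by positivity)]
    exact exp_le_one_iff.2 (by nlinarith [sq_nonneg (t - ⟪y, dirVec θ⟫_ℝ)])
  · have := continuous_oddProfile (2 * b)
    exact Continuous.aestronglyMeasurable (by fun_prop)
  · refine Eventually.of_forall fun y s _ => ?_
    rw [norm_mul, norm_neg, norm_of_nonneg (by positivity : 0 ≤ 2 * b), norm_eq_abs]
    gcongr
    exact abs_oddProfile_le (by positivity) _
  · refine Eventually.of_forall fun y s _ => ?_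
    have h1 := (((((hasDerivAt_id s).sub_const ⟪y, dirVec θ⟫_ℝ).pow 2).const_mul (-b)).exp)
    refine h1.congr_deriv ?_
    simp only [oddProfile, id, Pi.pow_apply]
    rw [show -(2 * b) * (s - ⟪y, dirVec θ⟫_ℝ) ^ 2 / 2 = -b * (s - ⟪y, dirVec θ⟫_ℝ) ^ 2 by ring]
    push_cast
    ring

/-- The marginal energy is a double integral of a Gaussian-type kernel over `E × E`. -/
lemma lintegral_deriv_margMollify_sq (hE : MeasurableSet E) (hE' : volume E ≠ ⊤) (hε : 0 < ε) :
    ∫⁻ θ in Icc (0 : ℝ) π, ∫⁻ t : ℝ, ENNReal.ofReal ((deriv (margMollify E ε θ) t) ^ 2) =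
      ENNReal.ofReal (1 / (4 * √π * ε ^ 3) * ∫ x in E, ∫ y in E, ∫ θ in Icc (0 : ℝ) π,
        evenProfile (1 / (2 * ε ^ 2)) ⟪x - y, dirVec θ⟫_ℝ) := by
  have : IsFiniteMeasure (volume.restrict E) := ⟨by simpa using hE'.lt_top⟩
  have hk : (1 / (2 * ε ^ 2) / π * √(π / (1 / (2 * ε ^ 2))) * (-(2 * (1 / (2 * ε ^ 2))))) ^ 2 *
      (√(π / (2 * (1 / (2 * ε ^ 2)))) / (4 * (1 / (2 * ε ^ 2)))) = 1 / (4 * √π * ε ^ 3) := by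
    have h1 : √(π / (2 * (1 / (2 * ε ^ 2)))) = √π * ε := by
      rw [show π / (2 * (1 / (2 * ε ^ 2))) = π * ε ^ 2 by field_simp, sqrt_mul pi_pos.le,
        sqrt_sq hε.le]
    have h2 : √(π / (1 / (2 * ε ^ 2))) ^ 2 = π * (2 * ε ^ 2) := by
      rw [sq_sqrt (by positivity)]; field_simp
    have h3 : √π ^ 2 = π := sq_sqrt pi_pos.le
    rw [h1, mul_pow, mul_pow, h2]
    field_simp
    linear_combination h3
  set b := 1 / (2 * ε ^ 2) with hb
  have hb0 : 0 < b := by positivity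
  set c := b / π * √(π / b) * (-(2 * b)) with hc
  have hmeas : ∀ θ, Measurable fun y : Plane => ⟪y, dirVec θ⟫_ℝ := fun θ => by fun_prop
  have hinner : ∀ θ, ∫⁻ t : ℝ, ENNReal.ofReal ((deriv (margMollify E ε θ) t) ^ 2) =
      ENNReal.ofReal (∫ t, (c * ∫ y in E, oddProfile (2 * b) (t - ⟪y, dirVec θ⟫_ℝ)) ^ 2) := by
    intro θ
    simp_rw [deriv_margMollify hE hE' hε θ, ← hb, ← hc]
    rw [ofReal_integral_eq_lintegral_ofReal]
    · simp_rw [mul_pow]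
      exact (integrable_sq_integral_oddProfile hb0 (hmeas θ)).const_mul _
    · exact Eventually.of_forall fun t => sq_nonneg _
  have hval : ∀ θ, ∫ t, (c * ∫ y in E, oddProfile (2 * b) (t - ⟪y, dirVec θ⟫_ℝ)) ^ 2 =
      1 / (4 * √π * ε ^ 3) * ∫ p, evenProfile b ⟪p.1 - p.2, dirVec θ⟫_ℝ
        ∂((volume.restrict E).prod (volume.restrict E)) := by
    intro θ
    simp_rw [mul_pow]
    rw [integral_const_mul, integral_sq_integral_oddProfile hb0 (hmeas θ), ← mul_assoc, hk]
    simp_rw [inner_sub_left]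
  have hfin : IsFiniteMeasure (volume.restrict (Icc (0 : ℝ) π)) :=
    ⟨by simp⟩
  have hKint : Integrable (fun q : ℝ × Plane × Plane =>
      evenProfile b ⟪q.2.1 - q.2.2, dirVec q.1⟫_ℝ)
      ((volume.restrict (Icc (0 : ℝ) π)).prod
        ((volume.restrict E).prod (volume.restrict E))) := by
    refine Integrable.of_bound (C := 4) (Continuous.aestronglyMeasurable ?_)
      (Eventually.of_forall fun q => abs_evenProfile_le hb0 _)
    have h1 := continuous_evenProfile b
    have h2 := continuous_dirVec
    fun_prop
  simp_rw [hinner]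
  rw [← ofReal_integral_eq_lintegral_ofReal]
  · simp_rw [hval]
    rw [integral_const_mul, integral_integral_swap hKint, integral_prod]
    exact hKint.integral_prod_right
  · simp_rw [hval]
    exact hKint.integral_prod_left.const_mul _
  · exact Eventually.of_forall fun θ => integral_nonneg fun t => sq_nonneg _

end Marginal

section RadialBound

variable {ε L : ℝ}

lemma radial_kernel_aux (ε L : ℝ) : EqOn
    (fun y : ℝ => y ^ (Module.finrank ℝ Plane - 1) •
      (Iio L).indicator (fun r => (r * (ε + r))⁻¹) y)
    ((Ioo 0 L).indicator fun y => (ε + y)⁻¹) (Ioi 0) := by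
  intro y (hy : 0 < y)
  by_cases hL : y < L
  · simp [hL, hy]
    field_simp
  · simp [hL]

lemma integrableOn_inv_add (hε : 0 < ε) : IntegrableOn (fun y : ℝ => (ε + y)⁻¹) (Ioo 0 L) := by
  refine (ContinuousOn.integrableOn_compact isCompact_Icc ?_).mono_set Ioo_subset_Icc_self
  exact ContinuousOn.inv₀ (by fun_prop) fun y hy => by have := hy.1; positivity

lemma integrable_radial_kernel (hε : 0 < ε) :
    Integrable fun z : Plane => (Iio L).indicator (fun r => (r * (ε + r))⁻¹) ‖z‖ := by
  rw [integrable_fun_norm_addHaar, integrableOn_congr_fun (radial_kernel_aux ε L) measurableSet_Ioi]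
  exact ((integrable_indicator_iff measurableSet_Ioo).2 (integrableOn_inv_add hε)).integrableOn

lemma integral_radial_kernel (hε : 0 < ε) (hL : 0 ≤ L) :
    ∫ z : Plane, (Iio L).indicator (fun r => (r * (ε + r))⁻¹) ‖z‖ =
      2 * π * log ((ε + L) / ε) := by
  rw [integral_fun_norm_addHaar, setIntegral_congr_fun measurableSet_Ioi (radial_kernel_aux ε L),
    setIntegral_indicator measurableSet_Ioo, inter_eq_right.2 Ioo_subset_Ioi_self,
    ← integral_Ioc_eq_integral_Ioo, ← intervalIntegral.integral_of_le hL,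
    intervalIntegral.integral_comp_add_left (fun y => y⁻¹) ε,
    integral_inv_of_pos (by linarith) (by linarith), Measure.real,
    InnerProductSpace.volume_ball_of_dim_even (k := 1) (by simp)]
  simp [pi_pos.le]
  ring

end RadialBound

/-- The vector field obtained by superposing over `E` translates of a cut off `waveField`. -/
noncomputable def testField (E : Set Plane) (χ : ContDiffBump (0 : Plane)) (b : ℝ) :
    Plane → Plane :=
  E.indicator (fun _ => (1 : ℝ)) ⋆[ContinuousLinearMap.lsmul ℝ ℝ, volume]
    (fun z => χ z • waveField b z)

section TestField

variable {E : Set Plane} {χ : ContDiffBump (0 : Plane)} {b ε : ℝ}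

lemma hasCompactSupport_cutoff (χ : ContDiffBump (0 : Plane)) (b : ℝ) :
    HasCompactSupport fun z => χ z • waveField b z :=
  χ.hasCompactSupport.smul_right

lemma contDiff_cutoff (χ : ContDiffBump (0 : Plane)) (b : ℝ) :
    ContDiff ℝ (⊤ : ℕ∞) fun z => χ z • waveField b z :=
  χ.contDiff.smul (contDiff_waveField b)

lemma integrable_indicator_one (hE : MeasurableSet E) (hE' : volume E ≠ ⊤) :
    Integrable (E.indicator fun _ => (1 : ℝ)) :=
  (integrable_indicator_iff hE).2 (integrableOn_const hE')

lemma contDiff_testField (hE : MeasurableSet E) (hE' : volume E ≠ ⊤) :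
    ContDiff ℝ (⊤ : ℕ∞) (testField E χ b) :=
  (hasCompactSupport_cutoff χ b).contDiff_convolution_right _
    (integrable_indicator_one hE hE').locallyIntegrable (contDiff_cutoff χ b)

lemma hasCompactSupport_testField (hE : Bornology.IsBounded E) :
    HasCompactSupport (testField E χ b) := by
  refine HasCompactSupport.convolution _ ?_ (hasCompactSupport_cutoff χ b)
  refine HasCompactSupport.intro hE.isCompact_closure fun x hx => ?_
  exact indicator_of_notMem (fun h => hx (subset_closure h)) _

lemma diverg_testField (hE : MeasurableSet E) (hE' : volume E ≠ ⊤)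
    (hχ : ∀ x ∈ E, ∀ y ∈ E, x - y ∈ Metric.ball 0 χ.rIn) {x : Plane} (hx : x ∈ E) :
    diverg (testField E χ b) x = ∫ y in E, diverg (waveField b) (x - y) := by
  set g : Plane → Plane := fun z => χ z • waveField b z with hg
  have hgc : HasCompactSupport g := hasCompactSupport_cutoff χ b
  have hgs : ContDiff ℝ 1 g := (contDiff_cutoff χ b).of_le (by exact_mod_cast le_top)
  have hloc := (integrable_indicator_one hE hE').locallyIntegrable
  have hcont : Continuous (fderiv ℝ g) := hgs.continuous_fderiv one_ne_zero
  have hfd := (hgc.hasFDerivAt_convolution_right (ContinuousLinearMap.lsmul ℝ ℝ)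
    hloc hgs x).fderiv
  have hint : ∀ v, IntegrableOn (fun y => fderiv ℝ g (x - y) v) E := by
    intro v
    have : IsFiniteMeasure (volume.restrict E) := ⟨by simpa using hE'.lt_top⟩
    have hc : Continuous fun z => fderiv ℝ g z v := by fun_prop
    obtain ⟨C, hC⟩ := hc.bounded_above_of_compact_support (hgc.fderiv_apply ℝ v)
    exact Integrable.of_bound (hc.comp (continuous_const.sub continuous_id)).aestronglyMeasurable C
      (Eventually.of_forall fun y => hC _)
  have hcoord : ∀ (v : Plane) (i : Fin 2), fderiv ℝ (testField E χ b) x v i =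
      ∫ y in E, fderiv ℝ g (x - y) v i := by
    intro v i
    have h1 : fderiv ℝ (testField E χ b) x v = ∫ y in E, fderiv ℝ g (x - y) v := by
      rw [testField, hfd, convolution_precompR_apply _ hloc (hgc.fderiv ℝ) hcont,
        convolution_lsmul, ← integral_indicator hE]
      congr 1 with y : 1
      by_cases hy : y ∈ E <;> simp [hy]
    rw [h1]
    exact ((EuclideanSpace.proj (𝕜 := ℝ) i : Plane →L[ℝ] ℝ).integral_comp_comm (hint v)).symm
  have hi : ∀ i : Fin 2, IntegrableOn
      (fun y => fderiv ℝ g (x - y) (EuclideanSpace.single i 1) i) E := fun i =>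
    (EuclideanSpace.proj (𝕜 := ℝ) i : Plane →L[ℝ] ℝ).integrable_comp (hint _)
  rw [diverg, Fin.sum_univ_two, hcoord, hcoord, ← integral_add (hi 0) (hi 1)]
  refine setIntegral_congr_fun hE fun y hy => ?_
  have heq : g =ᶠ[nhds (x - y)] waveField b := by
    filter_upwards [Metric.isOpen_ball.mem_nhds (hχ x hx y hy)] with z hz
    simp [hg, χ.one_of_mem_closedBall (Metric.ball_subset_closedBall hz)]
  simp only [diverg, Fin.sum_univ_two, heq.fderiv_eq]

lemma norm_testField_le (hε : 0 < ε) (x : Plane) :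
    ‖testField E χ (1 / (2 * ε ^ 2)) x‖ ≤
      16 * π ^ 2 * ε ^ 3 * (2 * π * log ((ε + χ.rOut) / ε)) := by
  set b := 1 / (2 * ε ^ 2)
  have hχ := χ.rOut_pos
  have hgi : Integrable fun z => ‖χ z • waveField b z‖ :=
    ((contDiff_cutoff χ b).continuous.integrable_of_hasCompactSupport
      (hasCompactSupport_cutoff χ b)).norm
  rw [testField, convolution_lsmul]
  calc ‖∫ y, E.indicator (fun _ => (1 : ℝ)) y • χ (x - y) • waveField b (x - y)‖
      ≤ ∫ y, ‖χ (x - y) • waveField b (x - y)‖ := by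
        refine norm_integral_le_of_norm_le (hgi.comp_sub_left x) (Eventually.of_forall fun y => ?_)
        rw [norm_smul (E.indicator _ y)]
        refine mul_le_of_le_one_left (norm_nonneg _) ?_
        by_cases hy : y ∈ E <;> simp [hy]
    _ = ∫ z, ‖χ z • waveField b z‖ :=
        integral_sub_left_eq_self (fun z => ‖χ z • waveField b z‖) volume x
    _ ≤ ∫ z : Plane, 16 * π ^ 2 * ε ^ 3 *
          (Iio χ.rOut).indicator (fun r => (r * (ε + r))⁻¹) ‖z‖ := by
        refine integral_mono_ae hgi ((integrable_radial_kernel hε).const_mul _) ?_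
        filter_upwards [Measure.ae_ne volume (0 : Plane)] with z hz
        by_cases hzL : ‖z‖ < χ.rOut
        · rw [indicator_of_mem (by exact hzL), norm_smul, norm_of_nonneg χ.nonneg]
          exact (mul_le_of_le_one_left (norm_nonneg _) χ.le_one).trans (norm_waveField_le hε hz)
        · rw [χ.zero_of_le_dist (by simpa using hzL), indicator_of_notMem (by exact hzL)]
          simp
    _ = _ := by rw [integral_const_mul, integral_radial_kernel hε hχ.le]

end TestField

lemma perimeter_nonneg {E : Set Plane} (hE : HasFinitePerimeter E) : 0 ≤ perimeter E := by
  refine le_csSup hE.2 ⟨0, contDiff_const, HasCompactSupport.zero, by simp, ?_⟩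
  simp [diverg]

lemma setIntegral_diverg_le {E : Set Plane} (hE : HasFinitePerimeter E) {X : Plane → Plane}
    (hX : ContDiff ℝ (⊤ : ℕ∞) X) (hX' : HasCompactSupport X) {M : ℝ} (hM : 0 < M)
    (hXM : ∀ x, ‖X x‖ ≤ M) : ∫ x in E, diverg X x ≤ M * perimeter E := by
  have h : M⁻¹ * ∫ x in E, diverg X x ≤ perimeter E := by
    refine le_csSup hE.2 ⟨fun x => M⁻¹ • X x, hX.const_smul M⁻¹,
      hX'.comp_left (g := fun v => M⁻¹ • v) (smul_zero _), ?_, ?_⟩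
    · intro x
      rw [norm_smul, norm_inv, norm_of_nonneg hM.le, inv_mul_le_iff₀ hM, mul_one]
      exact hXM x
    · have hd : ∀ x, diverg (fun x => M⁻¹ • X x) x = M⁻¹ * diverg X x := by
        intro x
        have := fderiv_fun_const_smul (hX.differentiable (by simp) x) M⁻¹
        simp [diverg, this, mul_add]
      rw [← integral_const_mul, ← integral_indicator hE.1]
      congr 1 with x
      by_cases hx : x ∈ E <;> simp [hx, hd]
  rwa [inv_mul_le_iff₀ hM] at h

/-- For a bounded set `E ⊆ ℝ²` of finite perimeter, the measures
`ν_ε = |log ε|⁻¹ |w_{θ,ε}'(t)|² dt dθ` on `ℝ × [0,π]` have total mass bounded,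
uniformly as `ε → 0`, by a constant times the perimeter of `E`. -/
theorem marginal_energy_measures_bounded (E : Set (EuclideanSpace ℝ (Fin 2)))
    (hEb : Bornology.IsBounded E) (hEp : HasFinitePerimeter E) :
    ∃ C : ℝ, 0 < C ∧ ∀ ε : ℝ, 0 < ε → ε < 1 / 2 →
      (ENNReal.ofReal |log ε|)⁻¹ *
          ∫⁻ θ in Icc (0 : ℝ) π, ∫⁻ t : ℝ,
            ENNReal.ofReal ((deriv (margMollify E ε θ) t) ^ 2) ≤
        ENNReal.ofReal (C * perimeter E) := by
  obtain ⟨R, hR0, hR⟩ := hEb.exists_pos_norm_le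
  have hE' : volume E ≠ ⊤ := hEb.measure_lt_top.ne
  let χ : ContDiffBump (0 : Plane) := ⟨2 * R + 1, 2 * R + 2, by linarith, by linarith⟩
  have hχ : ∀ x ∈ E, ∀ y ∈ E, x - y ∈ Metric.ball 0 χ.rIn := by
    intro x hx y hy
    rw [mem_ball_zero_iff]
    have h1 := norm_sub_le x y
    have h2 := hR x hx
    have h3 := hR y hy
    change ‖x - y‖ < 2 * R + 1
    linarith
  have hlog2 : 0 < log 2 := log_pos one_lt_two
  have hlogR : 0 < log (2 * R + 3) := log_pos (by linarith)
  refine ⟨8 * π ^ 3 / √π * (log (2 * R + 3) / log 2 + 1), by positivity, fun ε hε hε2 => ?_⟩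
  have hlogε : log 2 ≤ |log ε| := by
    rw [← abs_neg, ← log_inv]
    exact (log_le_log two_pos (by rw [le_inv_comm₀ two_pos hε]; linarith)).trans (le_abs_self _)
  have hlog_pos : 0 < log ((ε + χ.rOut) / ε) :=
    log_pos ((one_lt_div hε).2 (by linarith [χ.rOut_pos]))
  have hlog_le : log ((ε + χ.rOut) / ε) ≤ (log (2 * R + 3) / log 2 + 1) * |log ε| := by
    have hout : χ.rOut = 2 * R + 2 := rfl
    rw [hout, log_div (by positivity) hε.ne', add_mul, one_mul, div_mul_eq_mul_div, sub_eq_add_neg]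
    refine add_le_add ?_ (neg_le_abs _)
    rw [le_div_iff₀ hlog2]
    have : log (ε + (2 * R + 2)) ≤ log (2 * R + 3) := log_le_log (by positivity) (by linarith)
    gcongr
  have henergy : ∫ x in E, ∫ y in E, ∫ θ in Icc (0 : ℝ) π,
        evenProfile (1 / (2 * ε ^ 2)) ⟪x - y, dirVec θ⟫_ℝ ≤
      16 * π ^ 2 * ε ^ 3 * (2 * π * log ((ε + χ.rOut) / ε)) * perimeter E := by
    refine le_trans (le_of_eq ?_) (setIntegral_diverg_le hEp
      (contDiff_testField (χ := χ) (b := 1 / (2 * ε ^ 2)) hEp.1 hE')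
      (hasCompactSupport_testField hEb) (by positivity) (norm_testField_le hε))
    refine setIntegral_congr_fun hEp.1 fun x hx => ?_
    simp only [diverg_testField hEp.1 hE' hχ hx, diverg_waveField]
  rw [lintegral_deriv_margMollify_sq hEp.1 hE' hε, ENNReal.inv_mul_le_iff
    (ENNReal.ofReal_pos.2 (hlog2.trans_le hlogε)).ne' ENNReal.ofReal_ne_top,
    ← ENNReal.ofReal_mul (abs_nonneg _)]
  refine ENNReal.ofReal_le_ofReal ?_
  have hP := perimeter_nonneg hEp
  calc _ ≤ 1 / (4 * √π * ε ^ 3) *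
        (16 * π ^ 2 * ε ^ 3 * (2 * π * log ((ε + χ.rOut) / ε)) * perimeter E) := by gcongr
    _ = 8 * π ^ 3 / √π * log ((ε + χ.rOut) / ε) * perimeter E := by
        field_simp
        ring
    _ ≤ 8 * π ^ 3 / √π * ((log (2 * R + 3) / log 2 + 1) * |log ε|) * perimeter E := by gcongr
    _ = _ := by ring
end
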